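/- arXiv:1009.1292 — 11 statements merged into one kernel-verified Lean document; each statement's English description precedes it below -/
import Mathlib

section
/- Let 1 ≤ p ≤ ∞, let X be a complex Banach space and let T : X → X be a linear isometry (not necessarily surjective). Then for every complex polynomial P one has ‖P(T)‖_{X→X} ≤ ‖P(S)⊗Id_X‖_{ℓ^p(ℕ;X)→ℓ^p(ℕ;X)}. -/
open scoped ENNReal

theorem arch_aux (a d : ℝ) (n : ℕ) (h : ∀ m : ℕ, ((m : ℝ) + 1) * a ≤ ((m : ℝ) + n + 1) * d) :
    a ≤ d := by
  by_contra! hlt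
  obtain ⟨m, hm⟩ := exists_nat_gt ((n * d) / (a - d))
  rw [div_lt_iff₀ (by linarith)] at hm
  have := h m
  nlinarith

/-- Let `1 ≤ p ≤ ∞`, let `X` be a complex Banach space and let
`T : X → X` be a linear isometry (not necessarily surjective).  Then for every complex
polynomial `P` one has `‖P(T)‖ ≤ ‖P(S) ⊗ Id_X‖`, where `S ⊗ Id_X` is the right shift
on `ℓ^p(ℕ; X)`. -/
theorem matsaev_isometry (p : ℝ≥0∞) [Fact (1 ≤ p)]
    (X : Type*) [NormedAddCommGroup X] [NormedSpace ℂ X] [CompleteSpace X]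
    (T : X →L[ℂ] X) (hT : Isometry T)
    (S : lp (fun _ : ℕ => X) p →L[ℂ] lp (fun _ : ℕ => X) p)
    (hS : ∀ (x : lp (fun _ : ℕ => X) p) (j : ℕ),
      (S x : ∀ _ : ℕ, X) j = if j = 0 then 0 else (x : ∀ _ : ℕ, X) (j - 1))
    (P : Polynomial ℂ) :
    ‖Polynomial.aeval T P‖ ≤ ‖Polynomial.aeval S P‖ := by
  have hp1 : 1 ≤ p := Fact.out
  have hTn : ∀ (k : ℕ) (x : X), ‖(T ^ k) x‖ = ‖x‖ := by
    intro k
    induction k with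
    | zero => intro x; simp
    | succ k ih =>
      intro x
      rw [pow_succ, ContinuousLinearMap.mul_apply, ih]
      exact hT.norm_map_of_map_zero (map_zero T) x
  have hSk : ∀ (k : ℕ) (x : lp (fun _ : ℕ => X) p) (j : ℕ), k ≤ j →
      ((S ^ k) x : ∀ _ : ℕ, X) j = (x : ∀ _ : ℕ, X) (j - k) := by
    intro k
    induction k with
    | zero => intro x j _; simp
    | succ k ih =>
      intro x j hj
      rw [pow_succ, ContinuousLinearMap.mul_apply, ih _ _ (by omega), hS, if_neg (by omega)]
      congr 1
  refine ContinuousLinearMap.opNorm_le_bound _ (norm_nonneg _) fun x => ?_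
  set n := P.natDegree with hn
  set C := ‖Polynomial.aeval S P‖ with hC
  -- the test vectors
  have key : ∀ N : ℕ, ∃ y : lp (fun _ : ℕ => X) p,
      (∀ j, j ≤ N → ‖(y : ∀ _ : ℕ, X) j‖ = ‖x‖) ∧ (∀ j, N < j → (y : ∀ _ : ℕ, X) j = 0) ∧
      (∀ j, n ≤ j → j ≤ N →
        ‖(Polynomial.aeval S P y : ∀ _ : ℕ, X) j‖ = ‖Polynomial.aeval T P x‖) := by
    intro N
    let f : ℕ → X := fun j => if j ≤ N then (T ^ (N - j)) x else 0
    have hf : Memℓp f p := by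
      refine Memℓp.of_exponent_ge (p := p) (q := 0) (memℓp_zero ?_) zero_le
      refine (Set.finite_Iic N).subset fun j hj => ?_
      by_contra hc
      exact hj (if_neg hc)
    refine ⟨⟨f, hf⟩, ?_, ?_, ?_⟩
    · intro j hj
      change ‖f j‖ = _
      simp only [f, if_pos hj, hTn]
    · intro j hj
      change f j = _
      simp only [f, if_neg (not_le.2 hj)]
    · intro j hnj hjN
      rw [← hTn (N - j) (Polynomial.aeval T P x)]
      congr 1
      rw [Polynomial.aeval_eq_sum_range, Polynomial.aeval_eq_sum_range]
      simp only [ContinuousLinearMap.sum_apply, ContinuousLinearMap.smul_apply, lp.coeFn_sum,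
        Finset.sum_apply, lp.coeFn_smul, Pi.smul_apply, map_sum, map_smul]
      refine Finset.sum_congr rfl fun k hk => ?_
      rw [Finset.mem_range] at hk
      rw [hSk k _ j (by omega)]
      change _ • f (j - k) = _
      simp only [f]
      rw [if_pos (by omega), ← ContinuousLinearMap.mul_apply, ← pow_add]
      congr 3
      omega
  rcases eq_or_ne p ∞ with rfl | hp
  · obtain ⟨y, hy1, hy2, hy3⟩ := key n
    rw [← hy3 n le_rfl le_rfl]
    refine (lp.norm_apply_le_norm (by simp) _ n).trans ?_
    refine ((Polynomial.aeval S P).le_opNorm y).trans ?_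
    refine mul_le_mul_of_nonneg_left ?_ (norm_nonneg _)
    refine lp.norm_le_of_forall_le (norm_nonneg _) fun j => ?_
    rcases le_or_gt j n with h | h
    · exact (hy1 j h).le
    · rw [hy2 j h]; simp
  · have hq : 0 < p.toReal := ENNReal.toReal_pos (by rintro rfl; simp at hp1) hp
    rw [← Real.rpow_le_rpow_iff (norm_nonneg _) (by positivity) hq]
    refine arch_aux _ _ n fun m => ?_
    obtain ⟨y, hy1, hy2, hy3⟩ := key (n + m)
    have h1 := lp.sum_rpow_le_norm_rpow hq (Polynomial.aeval S P y) (Finset.Icc n (n + m))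
    rw [Finset.sum_congr rfl (g := fun _ => ‖Polynomial.aeval T P x‖ ^ p.toReal) (fun j hj => by
      rw [Finset.mem_Icc] at hj
      rw [hy3 j hj.1 hj.2])] at h1
    have h2 : ‖y‖ ^ p.toReal = ((m : ℝ) + n + 1) * ‖x‖ ^ p.toReal := by
      rw [lp.norm_rpow_eq_tsum hq, tsum_eq_sum (s := Finset.range (n + m + 1))]
      · rw [Finset.sum_congr rfl (g := fun _ => ‖x‖ ^ p.toReal) (fun j hj => by
          rw [Finset.mem_range] at hj
          rw [hy1 j (by omega)])]
        simp only [Finset.sum_const, Finset.card_range, nsmul_eq_mul, Nat.cast_add, Nat.cast_one]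
        ring
      · intro j hj
        rw [Finset.mem_range] at hj
        rw [hy2 j (by omega), norm_zero, Real.zero_rpow hq.ne']
    have h3 := Real.rpow_le_rpow (norm_nonneg _) ((Polynomial.aeval S P).le_opNorm y) hq.le
    rw [Real.mul_rpow (norm_nonneg _) (norm_nonneg _), h2] at h3
    rw [Real.mul_rpow (norm_nonneg _) (norm_nonneg _)]
    have h4 : (n + m + 1 - n : ℕ) = m + 1 := by omega
    simp only [Finset.sum_const, Nat.card_Icc, h4, nsmul_eq_mul, Nat.cast_add, Nat.cast_one] at h1
    calc _ ≤ _ := h1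
      _ ≤ _ := h3
      _ = _ := by ring
end

section
/- Let 1 ≤ p < ∞, let X be a complex Banach space and let P be a complex polynomial. Then the operator norm of P(S)⊗Id_X on ℓ^p(ℕ;X) equals the operator norm of P(S)⊗Id_X on ℓ^p(ℤ;X) and equals the operator norm of P(S₋)⊗Id_X on ℓ^p(ℕ;X). -/
open scoped ENNReal

namespace ShiftAux

variable {ι κ X : Type*} [NormedAddCommGroup X] [NormedSpace ℂ X]

/-- extend by zero at `none` -/
def ext0 (x : κ → X) : Option κ → X := fun o => o.elim 0 x

lemma sum_le (r : ℝ) (hr : 0 < r) (f : ι → Option κ)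
    (hf : ∀ i i' k, f i = some k → f i' = some k → i = i') (x : κ → X) (s : Finset ι) :
    ∃ t : Finset κ, ∑ i ∈ s, ‖ext0 x (f i)‖ ^ r = ∑ k ∈ t, ‖x k‖ ^ r := by
  classical
  induction s using Finset.induction_on with
  | empty => exact ⟨∅, by simp⟩
  | insert a s ha ih => 
    clear ih
    refine ⟨(insert a s).filterMap f (fun i i' k h h' => hf i i' k h h'), ?_⟩
    generalize insert a s = s
    induction s using Finset.induction_on with
    | empty => simp
    | insert a s ha ih => 
      rw [Finset.sum_insert ha, ih]
      cases h : f a with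
      | none => 
        have : (insert a s).filterMap f (fun i i' k h h' => hf i i' k h h')
          = s.filterMap f (fun i i' k h h' => hf i i' k h h') := by
          ext k; simp [h]
        rw [this]; simp [ext0, Real.zero_rpow hr.ne']
      | some k =>
        have : (insert a s).filterMap f (fun i i' k h h' => hf i i' k h h')
          = insert k (s.filterMap f (fun i i' k h h' => hf i i' k h h')) := by
          ext k'; simp [h, eq_comm]
        rw [this, Finset.sum_insert]
        · simp [ext0]
        · simp only [Finset.mem_filterMap, not_exists, not_and]
          intro i hi h'
          exact ha (hf a i k h h' ▸ hi)

variable {p : ℝ≥0∞} [Fact (1 ≤ p)]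

lemma cg (x : lp (fun _ : ι => X) p) {i j : ι} (h : i = j) :
    (x : ∀ _ : ι, X) i = (x : ∀ _ : ι, X) j := by rw [h]

lemma toReal_pos (hp : p ≠ ∞) : 0 < p.toReal :=
  ENNReal.toReal_pos (zero_lt_one.trans_le (Fact.out : 1 ≤ p)).ne' hp

lemma exists_pull (hp : p ≠ ∞) (f : ι → Option κ)
    (hf : ∀ i i' k, f i = some k → f i' = some k → i = i') :
    ∃ C : lp (fun _ : κ => X) p →L[ℂ] lp (fun _ : ι => X) p,
      (∀ x i, (C x : ∀ _ : ι, X) i = ext0 (x : ∀ _ : κ, X) (f i)) ∧ ∀ x, ‖C x‖ ≤ ‖x‖ := by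
  have hr := toReal_pos hp
  have key : ∀ (x : lp (fun _ : κ => X) p) (s : Finset ι),
      ∑ i ∈ s, ‖ext0 (x : ∀ _ : κ, X) (f i)‖ ^ p.toReal ≤ ‖x‖ ^ p.toReal := by
    intro x s
    obtain ⟨t, ht⟩ := sum_le p.toReal hr f hf x s
    rw [ht]
    exact lp.sum_rpow_le_norm_rpow hr x t
  let L : lp (fun _ : κ => X) p →ₗ[ℂ] lp (fun _ : ι => X) p :=
    { toFun := fun x => ⟨fun i => ext0 (x : ∀ _ : κ, X) (f i), memℓp_gen' (key x)⟩
      map_add' := by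
        intro x y
        ext i
        change ext0 (((x + y : lp (fun _ : κ => X) p)) : κ → X) (f i) = ext0 (x : κ → X) (f i) + ext0 (y : κ → X) (f i)
        cases f i with
        | none => exact (add_zero (0 : X)).symm
        | some k => rfl
      map_smul' := by
        intro c x
        ext i
        change ext0 (((c • x : lp (fun _ : κ => X) p)) : κ → X) (f i) = c • ext0 (x : κ → X) (f i)
        cases f i <;> simp [ext0] }
  have hL : ∀ x, ‖L x‖ ≤ ‖x‖ := fun x =>
    lp.norm_le_of_forall_sum_le hr (norm_nonneg x) (key x)
  exact ⟨L.mkContinuous 1 (by simpa using hL), fun x i => rfl, hL⟩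

lemma aeval_comm {U V : Type*} [NormedAddCommGroup U] [NormedSpace ℂ U]
    [NormedAddCommGroup V] [NormedSpace ℂ V] (A : U →L[ℂ] V) (S : U →L[ℂ] U) (T : V →L[ℂ] V)
    (h : ∀ x, A (S x) = T (A x)) (P : Polynomial ℂ) (x : U) :
    A (Polynomial.aeval S P x) = Polynomial.aeval T P (A x) := by
  have hpow : ∀ (n : ℕ) x, A ((S ^ n) x) = (T ^ n) (A x) := by
    intro n
    induction n with
    | zero => simp
    | succ n ih => intro x; rw [pow_succ, pow_succ, mul_apply_eq_comp, mul_apply_eq_comp, ih, h]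
  induction P using Polynomial.induction_on' with
  | add p q hp hq => simp [hp, hq]
  | monomial n a => 
    have := hpow n x
    simp only [Polynomial.aeval_monomial, Algebra.algebraMap_eq_smul_one, smul_mul_assoc, one_mul,
      ContinuousLinearMap.smul_apply, map_smul, this]

end ShiftAux

/-- For `1 ≤ p < ∞` and a complex Banach space `X`, the operator norms of
`P(S) ⊗ Id_X` on `ℓ^p(ℕ; X)`, of `P(S) ⊗ Id_X` on `ℓ^p(ℤ; X)` and of `P(S₋) ⊗ Id_X` on
`ℓ^p(ℕ; X)` all coincide, where `S` denotes the right shift and `S₋` the left shift. -/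
theorem shift_norm_equalities (p : ℝ≥0∞) [Fact (1 ≤ p)] (hp : p ≠ ∞)
    (X : Type*) [NormedAddCommGroup X] [NormedSpace ℂ X] [CompleteSpace X]
    (SN : lp (fun _ : ℕ => X) p →L[ℂ] lp (fun _ : ℕ => X) p)
    (hSN : ∀ (x : lp (fun _ : ℕ => X) p) (j : ℕ),
      (SN x : ∀ _ : ℕ, X) j = if j = 0 then 0 else (x : ∀ _ : ℕ, X) (j - 1))
    (SZ : lp (fun _ : ℤ => X) p →L[ℂ] lp (fun _ : ℤ => X) p)
    (hSZ : ∀ (x : lp (fun _ : ℤ => X) p) (j : ℤ),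
      (SZ x : ∀ _ : ℤ, X) j = (x : ∀ _ : ℤ, X) (j - 1))
    (Sm : lp (fun _ : ℕ => X) p →L[ℂ] lp (fun _ : ℕ => X) p)
    (hSm : ∀ (x : lp (fun _ : ℕ => X) p) (j : ℕ),
      (Sm x : ∀ _ : ℕ, X) j = (x : ∀ _ : ℕ, X) (j + 1))
    (P : Polynomial ℂ) :
    ‖Polynomial.aeval SN P‖ = ‖Polynomial.aeval SZ P‖ ∧
    ‖Polynomial.aeval SN P‖ = ‖Polynomial.aeval Sm P‖ := by
  obtain ⟨E, hE, hEn⟩ := ShiftAux.exists_pull (X := X) hp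
    (fun j : ℤ => if 0 ≤ j then some j.toNat else none) (by
      intro i i' k h h'
      simp only [Option.ite_none_right_eq_some, Option.some.injEq] at h h'
      omega)
  obtain ⟨R, hR, hRn⟩ := ShiftAux.exists_pull (X := X) hp
    (fun j : ℕ => some (j : ℤ)) (by
      intro i i' k h h'
      simp only [Option.some.injEq] at h h'
      omega)
  obtain ⟨J, hJ, hJn⟩ := ShiftAux.exists_pull (X := X) hp
    (fun j : ℤ => some (-j)) (by
      intro i i' k h h'
      simp only [Option.some.injEq] at h h'
      omega)
  obtain ⟨T, hT, hTn⟩ := ShiftAux.exists_pull (X := X) hp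
    (fun j : ℤ => some (j + 1)) (by
      intro i i' k h h'
      simp only [Option.some.injEq] at h h'
      omega)
  obtain ⟨S, hS, hSn⟩ := ShiftAux.exists_pull (X := X) hp
    (fun j : ℤ => some (j - 1)) (by
      intro i i' k h h'
      simp only [Option.some.injEq] at h h'
      omega)
  simp only [ShiftAux.ext0, Option.elim] at hR hJ hT hS
  replace hE : ∀ (x : lp (fun _ : ℕ => X) p) (j : ℤ), (E x : ∀ _ : ℤ, X) j =
      if 0 ≤ j then (x : ∀ _ : ℕ, X) j.toNat else 0 := by
    intro x j
    rw [hE]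
    split_ifs <;> rfl
  have hSS : S = SZ := by
    ext x j
    rw [hS, hSZ]
  subst hSS
  -- algebraic relations
  have hRE : ∀ x, R (E x) = x := by
    intro x; ext j; rw [hR, hE]; simp
  have hJJ : ∀ x, J (J x) = x := by
    intro x; ext j; rw [hJ, hJ]; simp
  have hTS : ∀ x, T (S x) = x := by
    intro x; ext j; rw [hT, hS]; simp
  have hST : ∀ x, S (T x) = x := by
    intro x; ext j; rw [hS, hT]; simp
  have hJS : ∀ x, J (S x) = T (J x) := by
    intro x; ext j; rw [hJ, hS, hT, hJ]; exact ShiftAux.cg _ (by ring)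
  have hES : ∀ x, E (SN x) = S (E x) := by
    intro x; ext j; rw [hE, hS, hE]
    rcases lt_trichotomy j 0 with h | h | h
    · rw [if_neg (by omega), if_neg (by omega)]
    · subst h; simp [hSN]
    · rw [if_pos (by omega), if_pos (by omega)]
      simp only [hSN]
      rw [if_neg (by omega)]
      exact ShiftAux.cg _ (by omega)
  have hRT : ∀ x, R (T x) = Sm (R x) := by
    intro x; ext j; rw [hR, hT, hSm, hR]; push_cast; rfl
  have hEn' : ∀ x, ‖E x‖ = ‖x‖ := fun x =>
    le_antisymm (hEn x) (by simpa [hRE] using hRn (E x))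
  have hJn' : ∀ x, ‖J x‖ = ‖x‖ := fun x =>
    le_antisymm (hJn x) (by simpa [hJJ] using hJn (J x))
  have hSn' : ∀ x, ‖S x‖ = ‖x‖ := fun x =>
    le_antisymm (hSn x) (by simpa [hTS] using hTn (S x))
  have hSm' : ∀ (m : ℕ) x, ‖(S ^ m) x‖ = ‖x‖ := by
    intro m
    induction m with
    | zero => simp
    | succ n ih => intro x; rw [pow_succ, mul_apply_eq_comp, ih, hSn']
  have hSj : ∀ (m : ℕ) (x : lp (fun _ : ℤ => X) p) (j : ℤ),
      ((S ^ m) x : ∀ _ : ℤ, X) j = (x : ∀ _ : ℤ, X) (j - m) := by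
    intro m
    induction m with
    | zero => simp
    | succ n ih =>
      intro x j
      rw [pow_succ, mul_apply_eq_comp, ih, hS]
      exact ShiftAux.cg _ (by push_cast; ring)
  have hbound : ∀ s : Finset ℤ, ∃ m : ℕ, ∀ j ∈ s, -(m : ℤ) ≤ j := by
    intro s
    induction s using Finset.induction_on with
    | empty => exact ⟨0, by simp⟩
    | insert a s ha ih =>
      obtain ⟨m, hm⟩ := ih
      refine ⟨m + a.natAbs, fun j hj => ?_⟩
      rcases Finset.mem_insert.1 hj with rfl | hj
      · omega
      · have := hm j hj
        omega
  have hr := ShiftAux.toReal_pos hp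
  have h1 : ‖Polynomial.aeval SN P‖ = ‖Polynomial.aeval S P‖ := by
    apply le_antisymm
    · refine ContinuousLinearMap.opNorm_le_bound _ (norm_nonneg _) fun x => ?_
      rw [← hEn', ShiftAux.aeval_comm E SN S hES, ← hEn' x]
      exact ContinuousLinearMap.le_opNorm _ _
    · refine ContinuousLinearMap.opNorm_le_bound _ (norm_nonneg _) fun x => ?_
      have hx := lp.hasSum_single hp x
      have h2 := ((Polynomial.aeval S P).continuous.tendsto x).comp hx
      refine le_of_tendsto_of_tendsto h2.norm (hx.norm.const_mul _) ?_
      refine Filter.Eventually.of_forall fun s => ?_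
      obtain ⟨m, hm⟩ := hbound s
      simp only [Function.comp]
      set z := ∑ i ∈ s, lp.single p i (x i) with hz
      have hz0 : ∀ j, j ∉ s → (z : ∀ _ : ℤ, X) j = 0 := by
        intro j hj
        rw [hz, lp.coeFn_sum, Finset.sum_apply]
        refine Finset.sum_eq_zero fun i hi => ?_
        rw [lp.single_apply_ne]
        rintro rfl; exact hj hi
      have hER : E (R ((S ^ m) z)) = (S ^ m) z := by
        ext j
        rw [hE]
        split_ifs with h
        · simp only [hR]
          exact ShiftAux.cg _ (by omega)
        · rw [hSj, hz0]
          intro hj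
          have := hm _ hj
          omega
      have hc : (S ^ m) (Polynomial.aeval S P z) = Polynomial.aeval S P ((S ^ m) z) :=
        ShiftAux.aeval_comm (S ^ m) S S (fun x => by
          rw [← mul_apply_eq_comp, ← mul_apply_eq_comp,
            ← pow_succ, ← pow_succ']) P z
      rw [← hSm' m, hc, ← hER, ← ShiftAux.aeval_comm E SN S hES, hEn']
      refine (ContinuousLinearMap.le_opNorm _ _).trans ?_
      gcongr
      exact (hRn _).trans (hSm' m z).le
  have h2 : ‖Polynomial.aeval S P‖ = ‖Polynomial.aeval T P‖ := by
    have hJT : ∀ x, J (T x) = S (J x) := by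
      intro x
      rw [← hJJ (S (J x)), hJS, hJJ]
    apply le_antisymm
    · refine ContinuousLinearMap.opNorm_le_bound _ (norm_nonneg _) fun x => ?_
      rw [← hJn', ShiftAux.aeval_comm J S T hJS, ← hJn' x]
      exact ContinuousLinearMap.le_opNorm _ _
    · refine ContinuousLinearMap.opNorm_le_bound _ (norm_nonneg _) fun x => ?_
      rw [← hJn', ShiftAux.aeval_comm J T S hJT, ← hJn' x]
      exact ContinuousLinearMap.le_opNorm _ _
  have h3 : ‖Polynomial.aeval T P‖ = ‖Polynomial.aeval Sm P‖ := by
    apply le_antisymm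
    · refine ContinuousLinearMap.opNorm_le_bound _ (norm_nonneg _) fun x => ?_
      refine lp.norm_le_of_forall_sum_le hr (by positivity) fun s => ?_
      obtain ⟨m, hm⟩ := hbound s
      have hcm : ∀ x, (S ^ m) (T x) = T ((S ^ m) x) := by
        intro x
        ext j
        rw [hSj, hT, hT, hSj]; exact ShiftAux.cg _ (by ring)
      have hc := ShiftAux.aeval_comm (S ^ m) T T hcm P x
      have hc2 := ShiftAux.aeval_comm R T Sm hRT P ((S ^ m) x)
      rw [← hc] at hc2
      set z := Polynomial.aeval T P x
      have e : ∑ i ∈ s, ‖(z : ∀ _ : ℤ, X) i‖ ^ p.toReal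
          = ∑ k ∈ s.image (fun j : ℤ => (j + (m : ℤ)).toNat),
            ‖(R ((S ^ m) z) : ∀ _ : ℕ, X) k‖ ^ p.toReal := by
        rw [Finset.sum_image]
        · refine Finset.sum_congr rfl fun j hj => ?_
          rw [hR, hSj]
          have := hm j hj
          rw [ShiftAux.cg z (show ((j + (m : ℤ)).toNat : ℤ) - m = j by omega)]
        · intro a ha b hb hab
          have := hm a ha
          have := hm b hb
          simp only at hab
          omega
      rw [e]
      refine (lp.sum_rpow_le_norm_rpow hr _ _).trans ?_
      gcongr
      rw [hc2]
      refine (ContinuousLinearMap.le_opNorm _ _).trans ?_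
      gcongr
      exact (hRn _).trans (hSm' m x).le
    · refine ContinuousLinearMap.opNorm_le_bound _ (norm_nonneg _) fun x => ?_
      have := ShiftAux.aeval_comm R T Sm hRT P (E x)
      rw [hRE] at this
      rw [← this]
      refine (hRn _).trans ?_
      rw [← hEn' x]
      exact ContinuousLinearMap.le_opNorm _ _
  exact ⟨h1, h1.trans (h2.trans h3)⟩
end

section
/- Let 1 ≤ p ≤ q ≤ 2. Then for every complex polynomial P, ‖P(S)‖_{ℓ^q(ℤ)→ℓ^q(ℤ)} ≤ ‖P(S)‖_{ℓ^p(ℤ)→ℓ^p(ℤ)}. -/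
open scoped ENNReal

/-- analytic family through `f` -/
noncomputable def ampF (f : ℂ) (w c : ℝ) (z : ℂ) : ℂ :=
  f * (((w ^ c)⁻¹ : ℝ) : ℂ) * Complex.exp (z * ((Real.log w : ℝ) : ℂ))

lemma ampF_self {f : ℂ} {w c : ℝ} (hw : 0 ≤ w) (hc : 0 < c) (hf : ‖f‖ ≤ w ^ c) :
    ampF f w c (c : ℂ) = f := by
  unfold ampF
  rcases hw.eq_or_lt with h | h
  · subst h
    rw [Real.zero_rpow hc.ne'] at hf
    have : f = 0 := norm_le_zero_iff.1 hf
    simp [this]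
  · have h1 : Complex.exp ((c : ℂ) * ((Real.log w : ℝ) : ℂ)) = ((w ^ c : ℝ) : ℂ) := by
      rw [Real.rpow_def_of_pos h, mul_comm (Real.log w)]
      push_cast
      rfl
    rw [h1, mul_assoc, ← Complex.ofReal_mul, inv_mul_cancel₀ (Real.rpow_pos_of_pos h c).ne']
    simp

lemma norm_ampF {f : ℂ} {w c : ℝ} (z : ℂ) :
    ‖ampF f w c z‖ = ‖f * (((w ^ c)⁻¹ : ℝ) : ℂ)‖ * Real.exp (z.re * Real.log w) := by
  unfold ampF
  rw [norm_mul, Complex.norm_exp]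
  congr 2
  simp

lemma norm_ampF_le {f : ℂ} {w c : ℝ} (hw : 0 ≤ w) (hc : 0 < c) (hf : ‖f‖ ≤ w ^ c) (z : ℂ) :
    ‖ampF f w c z‖ ≤ w ^ z.re := by
  rw [norm_ampF]
  rcases hw.eq_or_lt with h | h
  · subst h
    rw [Real.zero_rpow hc.ne'] at hf
    have : f = 0 := norm_le_zero_iff.1 hf
    simp [this]
    positivity
  · rw [Real.rpow_def_of_pos h z.re, mul_comm (Real.log w)]
    have hp := Real.rpow_pos_of_pos h c
    have : ‖f * (((w ^ c)⁻¹ : ℝ) : ℂ)‖ ≤ 1 := by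
      rw [norm_mul, Complex.norm_real, Real.norm_of_nonneg (by positivity), ← div_eq_mul_inv,
        div_le_one hp]
      exact hf
    have h2 := Real.exp_pos (z.re * Real.log w)
    nlinarith

lemma norm_ampF_bdd {f : ℂ} {w c : ℝ} (z : ℂ) (h0 : 0 ≤ z.re) (h1 : z.re ≤ 1) :
    ‖ampF f w c z‖ ≤ ‖f * (((w ^ c)⁻¹ : ℝ) : ℂ)‖ * Real.exp (|Real.log w|) := by
  rw [norm_ampF]
  gcongr
  calc z.re * Real.log w ≤ |z.re * Real.log w| := le_abs_self _
    _ = z.re * |Real.log w| := by rw [abs_mul, abs_of_nonneg h0]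
    _ ≤ 1 * |Real.log w| := by gcongr
    _ = _ := one_mul _

lemma differentiable_ampF (f : ℂ) (w c : ℝ) : Differentiable ℂ (ampF f w c) := by
  unfold ampF
  fun_prop

/-- finite bilinear form -/
noncomputable def bilF (K : ℤ → ℂ) (s t : Finset ℤ) (f g : ℤ → ℂ) : ℂ :=
  ∑ j ∈ s, ∑ i ∈ t, K (j - i) * f i * g j

/-- the bilinear form is bounded at exponent `r` -/
def GoodF (K : ℤ → ℂ) (M : ℝ) (s t : Finset ℤ) (w v : ℤ → ℝ) (r : ℝ) : Prop :=
  ∀ f g : ℤ → ℂ, (∀ i ∈ t, ‖f i‖ ≤ w i ^ r) → (∀ j ∈ s, ‖g j‖ ≤ v j ^ (1 - r)) →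
    ‖bilF K s t f g‖ ≤ M

lemma good_interp {K : ℤ → ℂ} {M : ℝ} (hM : 0 ≤ M) {s t : Finset ℤ} {w v : ℤ → ℝ}
    (hw : ∀ i, 0 ≤ w i) (hv : ∀ i, 0 ≤ v i) {l u c : ℝ} (hl0 : 0 ≤ l) (hu1 : u ≤ 1) (hlu : l < u)
    (hlc : l ≤ c) (hcu : c ≤ u) (hc0 : 0 < c) (hc1 : c < 1)
    (hl : GoodF K M s t w v l) (hu : GoodF K M s t w v u) : GoodF K M s t w v c := by
  intro f g hf hg
  have hc1' : 0 < 1 - c := by linarith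
  let F : ℂ → ℂ := fun z => bilF K s t (fun i => ampF (f i) (w i) c z)
    (fun j => ampF (g j) (v j) (1 - c) (1 - z))
  have hFc : F (c : ℂ) = bilF K s t f g := by
    refine Finset.sum_congr rfl fun j hj => Finset.sum_congr rfl fun i hi => ?_
    have e : (1 - (c : ℂ)) = ((1 - c : ℝ) : ℂ) := by push_cast; rfl
    simp only [e]
    rw [ampF_self (hw i) hc0 (hf i hi), ampF_self (hv j) hc1' (hg j hj)]
  have hFd : Differentiable ℂ F := by
    refine Differentiable.fun_sum fun j _ => Differentiable.fun_sum fun i _ => ?_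
    refine Differentiable.mul (Differentiable.mul (differentiable_const _)
      (differentiable_ampF _ _ _)) ?_
    exact (differentiable_ampF _ _ _).comp (by fun_prop)
  have hb : ∀ r, GoodF K M s t w v r → ∀ z ∈ Complex.re ⁻¹' {r}, ‖F z‖ ≤ M := by
    intro r hr z hz
    have hz' : z.re = r := hz
    refine hr _ _ (fun i hi => ?_) (fun j hj => ?_)
    · simpa [hz'] using norm_ampF_le (hw i) hc0 (hf i hi) z
    · simpa [hz'] using norm_ampF_le (hv j) hc1' (hg j hj) (1 - z)
  have key := Complex.HadamardThreeLines.norm_le_interp_of_mem_verticalClosedStrip' (f := F)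
    (z := (c : ℂ)) (a := M) (b := M) hlu
    (by simp [Complex.HadamardThreeLines.verticalClosedStrip, hlc, hcu]) hFd.diffContOnCl
    (by
      refine ⟨∑ j ∈ s, ∑ i ∈ t, ‖K (j - i)‖ *
        (‖f i * (((w i ^ c)⁻¹ : ℝ) : ℂ)‖ * Real.exp (|Real.log (w i)|)) *
        (‖g j * (((v j ^ (1 - c))⁻¹ : ℝ) : ℂ)‖ * Real.exp (|Real.log (v j)|)), ?_⟩
      rintro _ ⟨z, hz, rfl⟩
      have hz1 : l ≤ z.re := hz.1
      have hz2 : z.re ≤ u := hz.2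
      refine (norm_sum_le _ _).trans (Finset.sum_le_sum fun j _ =>
        (norm_sum_le _ _).trans (Finset.sum_le_sum fun i _ => ?_))
      rw [norm_mul, norm_mul]
      gcongr
      · exact norm_ampF_bdd z (by linarith) (by linarith)
      · exact norm_ampF_bdd (1 - z) (by simp; linarith) (by simp; linarith))
    (hb l hl) (hb u hu)
  rw [hFc, ← Real.rpow_add' hM (by simp)] at key
  simpa using key

/-- convolution kernel -/
noncomputable def kerF (P : Polynomial ℂ) (n : ℤ) : ℂ := if 0 ≤ n then P.coeff n.toNat else 0

lemma conv_eq (P : Polynomial ℂ) (x : ℤ → ℂ) (j : ℤ) (t : Finset ℤ)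
    (ht : ∀ k ∈ Finset.range (P.natDegree + 1), j - (k : ℤ) ∈ t) :
    ∑ k ∈ Finset.range (P.natDegree + 1), P.coeff k * x (j - k) =
      ∑ i ∈ t, kerF P (j - i) * x i := by
  refine Finset.sum_of_injOn (fun k : ℕ => j - (k : ℤ)) ?_ ?_ ?_ ?_
  · intro a _ b _ h
    simp at h
    exact h
  · intro k hk
    exact ht k hk
  · intro i _ hi
    unfold kerF
    split_ifs with h
    · have : P.coeff (j - i).toNat = 0 := by
        apply Polynomial.coeff_eq_zero_of_natDegree_lt
        by_contra hlt
        apply hi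
        refine ⟨(j - i).toNat, ?_, ?_⟩
        · simp only [Finset.coe_range, Set.mem_Iio]; omega
        · simp only; omega
      simp [this]
    · simp
  · intro k _
    simp [kerF]

lemma aeval_apply' {p : ℝ≥0∞} [Fact (1 ≤ p)]
    (Sp : lp (fun _ : ℤ => ℂ) p →L[ℂ] lp (fun _ : ℤ => ℂ) p)
    (hSp : ∀ (x : lp (fun _ : ℤ => ℂ) p) (j : ℤ),
      (Sp x : ∀ _ : ℤ, ℂ) j = (x : ∀ _ : ℤ, ℂ) (j - 1)) (P : Polynomial ℂ)
    (x : lp (fun _ : ℤ => ℂ) p) (j : ℤ) :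
    ((Polynomial.aeval Sp P) x : ∀ _ : ℤ, ℂ) j =
      ∑ k ∈ Finset.range (P.natDegree + 1), P.coeff k * (x : ∀ _ : ℤ, ℂ) (j - k) := by
  have hpow : ∀ (k : ℕ) (x : lp (fun _ : ℤ => ℂ) p) (j : ℤ),
      ((Sp ^ k) x : ∀ _ : ℤ, ℂ) j = (x : ∀ _ : ℤ, ℂ) (j - k) := by
    intro k
    induction k with
    | zero => intro x j; simp
    | succ k ih =>
      intro x j
      rw [pow_succ, ContinuousLinearMap.mul_apply, ih, hSp]
      congr 1
      push_cast
      ring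
  rw [Polynomial.aeval_eq_sum_range]
  rw [ContinuousLinearMap.sum_apply, lp.coeFn_sum, Finset.sum_apply]
  refine Finset.sum_congr rfl fun k _ => ?_
  rw [ContinuousLinearMap.smul_apply, lp.coeFn_smul, Pi.smul_apply, hpow, smul_eq_mul]

lemma holder_aux {s : Finset ℤ} {h v : ℤ → ℝ} (hh : ∀ i, 0 ≤ h i) (hv : ∀ i, 0 ≤ v i)
    {r : ℝ} (hr : 1 ≤ r) (hvs : ∑ i ∈ s, v i ≤ 1) :
    ∑ i ∈ s, h i * v i ^ (1 - 1 / r) ≤ (∑ i ∈ s, h i ^ r) ^ (1 / r) := by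
  rcases hr.eq_or_lt with rfl | hr
  · simp
  have hr0 : 0 < r := by linarith
  have hpq : r.HolderConjugate (Real.conjExponent r) := Real.HolderConjugate.conjExponent hr
  have e : 1 - 1 / r = 1 / Real.conjExponent r := by
    have := hpq.inv_add_inv_eq_one
    rw [one_div, one_div]; linarith
  have hs0 : 0 ≤ (∑ i ∈ s, h i ^ r) ^ (1 / r) :=
    Real.rpow_nonneg (Finset.sum_nonneg fun i _ => Real.rpow_nonneg (hh i) _) _
  have hq0 := hpq.symm.pos
  rw [e]
  refine (Real.inner_le_Lp_mul_Lq_of_nonneg s hpq (fun i _ => hh i)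
    (fun i _ => Real.rpow_nonneg (hv i) _)).trans ?_
  have : ∀ i ∈ s, (v i ^ (1 / Real.conjExponent r)) ^ Real.conjExponent r = v i := by
    intro i _
    rw [← Real.rpow_mul (hv i), one_div_mul_cancel hq0.ne', Real.rpow_one]
  rw [Finset.sum_congr rfl this]
  refine mul_le_of_le_one_right hs0 ?_
  exact Real.rpow_le_one (Finset.sum_nonneg fun i _ => hv i) hvs (by positivity)

lemma good_of_norm {p : ℝ≥0∞} [Fact (1 ≤ p)] (hp : 1 ≤ p.toReal)
    (Sp : lp (fun _ : ℤ => ℂ) p →L[ℂ] lp (fun _ : ℤ => ℂ) p)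
    (hSp : ∀ (x : lp (fun _ : ℤ => ℂ) p) (j : ℤ),
      (Sp x : ∀ _ : ℤ, ℂ) j = (x : ∀ _ : ℤ, ℂ) (j - 1)) (P : Polynomial ℂ)
    {s t : Finset ℤ} {w v : ℤ → ℝ} (hw : ∀ i, 0 ≤ w i) (hv : ∀ i, 0 ≤ v i)
    (hws : ∑ i ∈ t, w i ≤ 1) (hvs : ∑ i ∈ s, v i ≤ 1) :
    GoodF (kerF P) ‖Polynomial.aeval Sp P‖ s t w v (1 / p.toReal) := by
  intro f g hf hg
  have hp0 : 0 < p.toReal := by linarith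
  let f' : ℤ → ℂ := fun i => if i ∈ t then f i else 0
  have hbd : ∀ s' : Finset ℤ, ∑ i ∈ s', ‖f' i‖ ^ p.toReal ≤ 1 := by
    intro s'
    refine le_trans ?_ hws
    have h1 : ∀ i ∈ s', ‖f' i‖ ^ p.toReal ≤ if i ∈ t then w i else 0 := by
      intro i _
      by_cases hi : i ∈ t
      · simp only [f', hi, if_true]
        calc ‖f i‖ ^ p.toReal ≤ (w i ^ (1 / p.toReal)) ^ p.toReal := by
              gcongr; exact hf i hi
          _ = w i := by
              rw [← Real.rpow_mul (hw i), one_div_mul_cancel hp0.ne', Real.rpow_one]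
      · simp [f', hi, Real.zero_rpow hp0.ne']
    refine (Finset.sum_le_sum h1).trans ?_
    rw [← Finset.sum_filter]
    refine Finset.sum_le_sum_of_subset_of_nonneg ?_ (fun i _ _ => hw i)
    intro i hi
    exact (Finset.mem_filter.1 hi).2
  let F : lp (fun _ : ℤ => ℂ) p := ⟨f', memℓp_gen' hbd⟩
  have hF : ‖F‖ ≤ 1 := lp.norm_le_of_forall_sum_le hp0 zero_le_one (by
    intro s'
    rw [Real.one_rpow]
    exact hbd s')
  set T := Polynomial.aeval Sp P with hT
  have hTF : ‖T F‖ ≤ ‖T‖ := by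
    simpa using T.le_opNorm_of_le hF
  have hconv : ∀ j, ((T F : lp (fun _ : ℤ => ℂ) p) : ∀ _ : ℤ, ℂ) j =
      ∑ i ∈ t, kerF P (j - i) * f i := by
    intro j
    rw [hT, aeval_apply' Sp hSp, conv_eq P _ j
      (t ∪ (Finset.range (P.natDegree + 1)).image (fun k : ℕ => j - (k : ℤ)))]
    · rw [← Finset.sum_subset Finset.subset_union_left]
      · refine Finset.sum_congr rfl fun i hi => ?_
        change _ * f' i = _
        simp [f', hi]
      · intro i _ hi
        change _ * f' i = _
        simp [f', hi]
    · intro k hk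
      exact Finset.mem_union_right _ (Finset.mem_image_of_mem _ hk)
  have e : bilF (kerF P) s t f g =
      ∑ j ∈ s, ((T F : lp (fun _ : ℤ => ℂ) p) : ∀ _ : ℤ, ℂ) j * g j := by
    refine Finset.sum_congr rfl fun j _ => ?_
    rw [hconv, Finset.sum_mul]
  rw [e]
  calc _ ≤ ∑ j ∈ s, ‖((T F : lp (fun _ : ℤ => ℂ) p) : ∀ _ : ℤ, ℂ) j‖ *
        v j ^ (1 - 1 / p.toReal) := by
        refine (norm_sum_le _ _).trans (Finset.sum_le_sum fun j hj => ?_)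
        rw [norm_mul]
        gcongr
        exact hg j hj
    _ ≤ _ := holder_aux (fun _ => norm_nonneg _) hv hp hvs
    _ ≤ (‖T F‖ ^ p.toReal) ^ (1 / p.toReal) := by
        gcongr
        exact lp.sum_rpow_le_norm_rpow hp0 (T F) s
    _ = ‖T F‖ := by
        rw [← Real.rpow_mul (norm_nonneg _), mul_one_div_cancel hp0.ne', Real.rpow_one]
    _ ≤ ‖T‖ := hTF

lemma bilF_reflect (K : ℤ → ℂ) (s t : Finset ℤ) (f g : ℤ → ℂ) :
    bilF K (t.map (Equiv.neg ℤ).toEmbedding) (s.map (Equiv.neg ℤ).toEmbedding)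
      (fun i => g (-i)) (fun i => f (-i)) = bilF K s t f g := by
  unfold bilF
  simp only [Finset.sum_map]
  rw [Finset.sum_comm]
  refine Finset.sum_congr rfl fun j _ => Finset.sum_congr rfl fun i _ => ?_
  have : -i - -j = j - i := by ring
  simp [this]
  ring

/-- Let `1 ≤ p ≤ q ≤ 2`.  Then for every complex polynomial `P`, the
operator norm of `P(S)` on `ℓ^q(ℤ)` is at most the operator norm of `P(S)` on `ℓ^p(ℤ)`,
where `S` is the right shift. -/
theorem shift_norm_monotone (p q : ℝ≥0∞) [Fact (1 ≤ p)] [Fact (1 ≤ q)]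
    (hpq : p ≤ q) (hq : q ≤ 2)
    (Sp : lp (fun _ : ℤ => ℂ) p →L[ℂ] lp (fun _ : ℤ => ℂ) p)
    (hSp : ∀ (x : lp (fun _ : ℤ => ℂ) p) (j : ℤ),
      (Sp x : ∀ _ : ℤ, ℂ) j = (x : ∀ _ : ℤ, ℂ) (j - 1))
    (Sq : lp (fun _ : ℤ => ℂ) q →L[ℂ] lp (fun _ : ℤ => ℂ) q)
    (hSq : ∀ (x : lp (fun _ : ℤ => ℂ) q) (j : ℤ),
      (Sq x : ∀ _ : ℤ, ℂ) j = (x : ∀ _ : ℤ, ℂ) (j - 1))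
    (P : Polynomial ℂ) :
    ‖Polynomial.aeval Sq P‖ ≤ ‖Polynomial.aeval Sp P‖ := by
  rcases hpq.eq_or_lt with heq | hlt
  · subst heq
    have : Sp = Sq := by
      ext x j
      rw [hSp, hSq]
    rw [this]
  have h1p : 1 ≤ p := Fact.out
  have hqt : q ≠ ⊤ := ne_top_of_le_ne_top (by simp) hq
  have hpt : p ≠ ⊤ := ne_top_of_lt hlt
  have hp1 : 1 ≤ p.toReal := by
    simpa using ENNReal.toReal_mono hpt h1p
  have hpq' : p.toReal < q.toReal := (ENNReal.toReal_lt_toReal hpt hqt).2 hlt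
  have hq2 : q.toReal ≤ 2 := by
    simpa using ENNReal.toReal_mono (by simp) hq
  have hp0 : 0 < p.toReal := by linarith
  have hq0 : 0 < q.toReal := by linarith
  set M := ‖Polynomial.aeval Sp P‖ with hM
  have hM0 : 0 ≤ M := norm_nonneg _
  have hcu : 1 / q.toReal < 1 / p.toReal := one_div_lt_one_div_of_lt hp0 hpq'
  have hc2 : 1 / 2 ≤ 1 / q.toReal := one_div_le_one_div_of_le hq0 hq2
  have hu1 : 1 / p.toReal ≤ 1 := by rw [div_le_one hp0]; exact hp1
  -- goodness at exponent 1/q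
  have good : ∀ (s t : Finset ℤ) (w v : ℤ → ℝ), (∀ i, 0 ≤ w i) → (∀ i, 0 ≤ v i) →
      ∑ i ∈ t, w i ≤ 1 → ∑ i ∈ s, v i ≤ 1 → GoodF (kerF P) M s t w v (1 / q.toReal) := by
    intro s t w v hw hv hws hvs
    refine good_interp hM0 hw hv (l := 1 - 1 / p.toReal) (u := 1 / p.toReal) (by linarith) hu1
      (by linarith) (by linarith) hcu.le (by positivity) (by linarith) ?_
      (good_of_norm hp1 Sp hSp P hw hv hws hvs)
    intro f g hf hg
    rw [← bilF_reflect]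
    refine good_of_norm hp1 Sp hSp P (w := fun i => v (-i)) (v := fun i => w (-i))
      (fun i => hv _) (fun i => hw _) ?_ ?_ _ _ ?_ ?_
    · simpa [Finset.sum_map] using hvs
    · simpa [Finset.sum_map] using hws
    · intro i hi
      have := hg (-i) (by simpa using hi)
      simpa using this
    · intro i hi
      exact hf (-i) (by simpa using hi)
  refine ContinuousLinearMap.opNorm_le_bound _ hM0 fun x => ?_
  rcases eq_or_ne x 0 with rfl | hx
  · simp
  have hxn : 0 < ‖x‖ := norm_pos_iff.2 hx
  refine lp.norm_le_of_forall_sum_le hq0 (by positivity) fun s => ?_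
  set h : ℤ → ℂ := fun j => ((Polynomial.aeval Sq P x : lp (fun _ : ℤ => ℂ) q) : ∀ _ : ℤ, ℂ) j
    with hh
  change ∑ i ∈ s, ‖h i‖ ^ q.toReal ≤ _
  set N := ∑ i ∈ s, ‖h i‖ ^ q.toReal with hN
  have hN0 : 0 ≤ N := Finset.sum_nonneg fun i _ => by positivity
  rcases hN0.eq_or_lt with hN0' | hNpos
  · rw [← hN0']; positivity
  let t : Finset ℤ := s.biUnion fun j =>
    (Finset.range (P.natDegree + 1)).image (fun k : ℕ => j - (k : ℤ))
  have hconv : ∀ j ∈ s, h j = ∑ i ∈ t, kerF P (j - i) * (x : ∀ _ : ℤ, ℂ) i := by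
    intro j hj
    rw [hh]
    simp only
    rw [aeval_apply' Sq hSq, conv_eq P _ j t]
    intro k hk
    exact Finset.mem_biUnion.2 ⟨j, hj, Finset.mem_image_of_mem _ hk⟩
  set r := q.toReal with hr
  let w : ℤ → ℝ := fun i => (‖(x : ∀ _ : ℤ, ℂ) i‖ / ‖x‖) ^ r
  let v : ℤ → ℝ := fun j => ‖h j‖ ^ r / N
  let g : ℤ → ℂ := fun j => (starRingEnd ℂ (h j)) * ((‖h j‖ ^ (r - 2) / N ^ (1 - 1 / r) : ℝ) : ℂ)
  let f : ℤ → ℂ := fun i => ((‖x‖⁻¹ : ℝ) : ℂ) * (x : ∀ _ : ℤ, ℂ) i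
  have hNp : 0 < N ^ (1 - 1 / r) := Real.rpow_pos_of_pos hNpos _
  have hmain : ‖bilF (kerF P) s t f g‖ ≤ M := by
    refine good s t w v (fun i => by positivity) (fun i => by positivity) ?_ ?_ f g ?_ ?_
    · have : ∀ i ∈ t, w i = ‖(x : ∀ _ : ℤ, ℂ) i‖ ^ r / ‖x‖ ^ r := fun i _ =>
        Real.div_rpow (norm_nonneg _) (norm_nonneg _) _
      rw [Finset.sum_congr rfl this, ← Finset.sum_div, div_le_one (by positivity)]
      exact lp.sum_rpow_le_norm_rpow hq0 x t
    · rw [← Finset.sum_div, div_self hNpos.ne']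
    · intro i _
      have : w i ^ (1 / r) = ‖(x : ∀ _ : ℤ, ℂ) i‖ / ‖x‖ := by
        rw [← Real.rpow_mul (by positivity), mul_one_div_cancel hq0.ne', Real.rpow_one]
      rw [this, norm_mul, Complex.norm_real, Real.norm_of_nonneg (by positivity)]
      rw [div_eq_inv_mul]
    · intro j _
      rcases eq_or_ne (h j) 0 with h0 | h0
      · simp only [g, h0, map_zero, zero_mul, norm_zero]
        positivity
      have hhp : 0 < ‖h j‖ := norm_pos_iff.2 h0
      have e1 : v j ^ (1 - 1 / r) = ‖h j‖ ^ (r - 1) / N ^ (1 - 1 / r) := by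
        rw [Real.div_rpow (by positivity) hN0, ← Real.rpow_mul hhp.le]
        congr 2
        field_simp
      rw [e1, norm_mul, Complex.norm_real, Real.norm_of_nonneg (by positivity), RCLike.norm_conj,
        ← mul_div_assoc]
      apply le_of_eq
      congr 1
      nth_rewrite 1 [← Real.rpow_one ‖h j‖]
      rw [← Real.rpow_add hhp]
      congr 1
      ring
  have hval : bilF (kerF P) s t f g = ((N / (‖x‖ * N ^ (1 - 1 / r)) : ℝ) : ℂ) := by
    have h1 : ∀ j ∈ s, ∑ i ∈ t, kerF P (j - i) * f i * g j =
        ((‖h j‖ ^ r / (‖x‖ * N ^ (1 - 1 / r)) : ℝ) : ℂ) := by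
      intro j hj
      have : ∑ i ∈ t, kerF P (j - i) * f i * g j = ((‖x‖⁻¹ : ℝ) : ℂ) * (h j * g j) := by
        rw [hconv j hj, Finset.sum_mul, Finset.mul_sum]
        refine Finset.sum_congr rfl fun i _ => ?_
        simp only [f]
        ring
      rw [this]
      simp only [g]
      rw [← mul_assoc (h j), Complex.mul_conj, Complex.normSq_eq_norm_sq, ← Complex.ofReal_mul,
        ← Complex.ofReal_mul]
      congr 1
      rcases eq_or_ne (h j) 0 with h0 | h0
      · simp [h0, Real.zero_rpow hq0.ne']
      have hhp : 0 < ‖h j‖ := norm_pos_iff.2 h0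
      have : ‖h j‖ ^ r = ‖h j‖ ^ 2 * ‖h j‖ ^ (r - 2) := by
        rw [← Real.rpow_natCast, ← Real.rpow_add hhp]
        congr 1
        push_cast
        ring
      rw [this]
      field_simp
    unfold bilF
    rw [Finset.sum_congr rfl h1, ← Complex.ofReal_sum, ← Finset.sum_div]
  rw [hval, Complex.norm_real, Real.norm_of_nonneg (by positivity), div_le_iff₀ (by positivity)]
    at hmain
  have hsplit : N = N ^ (1 / r) * N ^ (1 - 1 / r) := by
    rw [← Real.rpow_add hNpos]
    simp
  have hfin : N ^ (1 / r) ≤ M * ‖x‖ := by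
    refine le_of_mul_le_mul_right ?_ hNp
    rw [← hsplit]
    linarith
  calc N = (N ^ (1 / r)) ^ r := by
        rw [← Real.rpow_mul hN0, one_div_mul_cancel hq0.ne', Real.rpow_one]
    _ ≤ _ := by gcongr
end

section
/- Let n ≥ 1 and let a_0, a_1, …, a_n be nonzero real numbers, and set P(z) = Σ_{k=0}^n a_k z^k. Then sup_{|z|=1} |P(z)| = Σ_{k=0}^n |a_k| if and only if either all the a_k have the same sign, or the signs of the a_k are alternating (i.e. a_k·a_{k+1} < 0 for every 0 ≤ k ≤ n−1). -/
theorem same_sign_of_mul_pos (n : ℕ) (b : ℕ → ℝ) (h0 : b 0 ≠ 0)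
    (h : ∀ k < n, 0 < b k * b (k + 1)) :
    (∀ k ≤ n, 0 < b k) ∨ (∀ k ≤ n, b k < 0) := by
  rcases lt_or_gt_of_ne h0 with h0 | h0
  · right
    intro k
    induction k with
    | zero => intro _; exact h0
    | succ k ih =>
      intro hk
      have h1 := ih (by omega)
      have h2 := h k (by omega)
      by_contra h3
      nlinarith
  · left
    intro k
    induction k with
    | zero => intro _; exact h0
    | succ k ih =>
      intro hk
      have h1 := ih (by omega)
      have h2 := h k (by omega)
      by_contra h3
      nlinarith

theorem abs_sum_of_same_sign (n : ℕ) (b : ℕ → ℝ)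
    (h : (∀ k ≤ n, 0 < b k) ∨ (∀ k ≤ n, b k < 0)) :
    |∑ k ∈ Finset.range (n + 1), b k| = ∑ k ∈ Finset.range (n + 1), |b k| := by
  rcases h with h | h
  · have h' : ∀ k ∈ Finset.range (n + 1), 0 ≤ b k := fun k hk =>
      (h k (by simpa [Nat.lt_succ_iff] using hk)).le
    rw [abs_of_nonneg (Finset.sum_nonneg h')]
    exact Finset.sum_congr rfl fun k hk => (abs_of_nonneg (h' k hk)).symm
  · have h' : ∀ k ∈ Finset.range (n + 1), b k ≤ 0 := fun k hk =>
      (h k (by simpa [Nat.lt_succ_iff] using hk)).le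
    rw [abs_of_nonpos (Finset.sum_nonpos h'), ← Finset.sum_neg_distrib]
    exact Finset.sum_congr rfl fun k hk => (abs_of_nonpos (h' k hk)).symm

theorem norm_poly_le (n : ℕ) (a : ℕ → ℝ) (z : ℂ) (hz : ‖z‖ = 1) :
    ‖∑ k ∈ Finset.range (n + 1), (a k : ℂ) * z ^ k‖ ≤ ∑ k ∈ Finset.range (n + 1), |a k| := by
  refine (norm_sum_le _ _).trans (le_of_eq ?_)
  exact Finset.sum_congr rfl fun k _ => by simp [hz]

theorem sup_eq_of_real (n : ℕ) (a : ℕ → ℝ) (e : ℝ) (he : |e| = 1)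
    (h : (∀ k ≤ n, 0 < a k * e ^ k) ∨ (∀ k ≤ n, a k * e ^ k < 0)) :
    (⨆ z : Metric.sphere (0 : ℂ) 1,
        ‖∑ k ∈ Finset.range (n + 1), (a k : ℂ) * (z : ℂ) ^ k‖)
      = ∑ k ∈ Finset.range (n + 1), |a k| := by
  have hb : ∀ z : Metric.sphere (0 : ℂ) 1,
      ‖∑ k ∈ Finset.range (n + 1), (a k : ℂ) * (z : ℂ) ^ k‖
        ≤ ∑ k ∈ Finset.range (n + 1), |a k| := fun z =>
    norm_poly_le n a z (by simpa using z.2)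
  have hmem : (e : ℂ) ∈ Metric.sphere (0 : ℂ) 1 := by simp [he]
  haveI : Nonempty (Metric.sphere (0 : ℂ) 1) := ⟨⟨e, hmem⟩⟩
  apply le_antisymm (ciSup_le hb)
  refine le_trans (le_of_eq ?_) (le_ciSup ⟨_, by rintro _ ⟨z, rfl⟩; exact hb z⟩ ⟨(e : ℂ), hmem⟩)
  have h1 := abs_sum_of_same_sign n (fun k => a k * e ^ k) h
  have h2 : ∑ k ∈ Finset.range (n + 1), (a k : ℂ) * (e : ℂ) ^ k
      = ((∑ k ∈ Finset.range (n + 1), a k * e ^ k : ℝ) : ℂ) := by push_cast; rfl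
  show _ = ‖∑ k ∈ Finset.range (n + 1), (a k : ℂ) * (e : ℂ) ^ k‖
  rw [h2, Complex.norm_real, Real.norm_eq_abs, h1]
  exact Finset.sum_congr rfl fun k _ => by simp [abs_mul, he]

theorem pair_eq (n : ℕ) (a : ℕ → ℝ) (z : ℂ) (hz : ‖z‖ = 1)
    (h : ‖∑ k ∈ Finset.range (n + 1), (a k : ℂ) * z ^ k‖ = ∑ k ∈ Finset.range (n + 1), |a k|)
    (k : ℕ) (hk : k < n) : |a k * a (k + 1)| = a k * a (k + 1) * z.re := by
  have hsub : ({k, k + 1} : Finset ℕ) ⊆ Finset.range (n + 1) := by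
    intro j hj
    simp only [Finset.mem_insert, Finset.mem_singleton] at hj
    simp only [Finset.mem_range]
    omega
  rw [← Finset.sum_sdiff hsub, ← Finset.sum_sdiff hsub, Finset.sum_pair (by omega),
    Finset.sum_pair (by omega)] at h
  have h1 : ‖∑ j ∈ Finset.range (n + 1) \ {k, k + 1}, (a j : ℂ) * z ^ j‖
      ≤ ∑ j ∈ Finset.range (n + 1) \ {k, k + 1}, |a j| := by
    refine (norm_sum_le _ _).trans (le_of_eq ?_)
    exact Finset.sum_congr rfl fun k _ => by simp [hz]
  have h2 := norm_add_le (∑ j ∈ Finset.range (n + 1) \ {k, k + 1}, (a j : ℂ) * z ^ j)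
    ((a k : ℂ) * z ^ k + (a (k + 1) : ℂ) * z ^ (k + 1))
  have h3 : ‖(a k : ℂ) * z ^ k + (a (k + 1) : ℂ) * z ^ (k + 1)‖
      = ‖(a k : ℂ) + (a (k + 1) : ℂ) * z‖ := by
    have : (a k : ℂ) * z ^ k + (a (k + 1) : ℂ) * z ^ (k + 1)
      = z ^ k * ((a k : ℂ) + (a (k + 1) : ℂ) * z) := by ring
    rw [this, norm_mul, norm_pow, hz, one_pow, one_mul]
  have h4 : |a k| + |a (k + 1)| ≤ ‖(a k : ℂ) + (a (k + 1) : ℂ) * z‖ := by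
    rw [← h3]; linarith
  have h5 : ‖(a k : ℂ) + (a (k + 1) : ℂ) * z‖ ^ 2
      = (a k + a (k + 1) * z.re) ^ 2 + (a (k + 1) * z.im) ^ 2 := by
    rw [← Complex.normSq_eq_norm_sq, Complex.normSq_apply]
    simp
    ring
  have h6 : z.re ^ 2 + z.im ^ 2 = 1 := by
    have := Complex.normSq_eq_norm_sq z
    rw [Complex.normSq_apply, hz] at this
    linarith
  have h7 : (|a k| + |a (k + 1)|) ^ 2 ≤ ‖(a k : ℂ) + (a (k + 1) : ℂ) * z‖ ^ 2 :=
    pow_le_pow_left₀ (by positivity) h4 2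
  have h8 : |z.re| ≤ 1 := hz ▸ Complex.abs_re_le_norm z
  apply le_antisymm
  · rw [h5] at h7
    have e1 := sq_abs (a k)
    have e2 := sq_abs (a (k + 1))
    have e3 : (a (k + 1)) ^ 2 * (z.re ^ 2 + z.im ^ 2) = (a (k + 1)) ^ 2 := by rw [h6, mul_one]
    rw [abs_mul]
    nlinarith
  · calc a k * a (k + 1) * z.re ≤ |a k * a (k + 1) * z.re| := le_abs_self _
      _ = |a k * a (k + 1)| * |z.re| := abs_mul _ _
      _ ≤ |a k * a (k + 1)| * 1 := by gcongr
      _ = _ := mul_one _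

/-- Let `n ≥ 1` and let `a_0, …, a_n` be nonzero real numbers, and set
`P(z) = Σ_{k=0}^n a_k z^k`.  Then `sup_{|z|=1} |P(z)| = Σ_{k=0}^n |a_k|` if and only if
either all the `a_k` have the same sign, or the signs of the `a_k` are alternating. -/
theorem sup_circle_eq_sum_abs_iff (n : ℕ) (hn : 1 ≤ n) (a : ℕ → ℝ)
    (ha : ∀ k ≤ n, a k ≠ 0) :
    (⨆ z : Metric.sphere (0 : ℂ) 1,
        ‖∑ k ∈ Finset.range (n + 1), (a k : ℂ) * (z : ℂ) ^ k‖)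
      = ∑ k ∈ Finset.range (n + 1), |a k| ↔
    (((∀ k ≤ n, 0 < a k) ∨ (∀ k ≤ n, a k < 0)) ∨
      (∀ k < n, a k * a (k + 1) < 0)) := by
  constructor
  · intro h
    haveI : Nonempty (Metric.sphere (0 : ℂ) 1) := ⟨⟨1, by simp⟩⟩
    haveI : CompactSpace (Metric.sphere (0 : ℂ) 1) :=
      isCompact_iff_compactSpace.mp (isCompact_sphere 0 1)
    have hc : Continuous fun z : Metric.sphere (0 : ℂ) 1 =>
        ‖∑ k ∈ Finset.range (n + 1), (a k : ℂ) * (z : ℂ) ^ k‖ := by fun_prop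
    obtain ⟨z, -, hz⟩ := isCompact_univ.exists_isMaxOn Set.univ_nonempty hc.continuousOn
    have hz1 : ‖(z : ℂ)‖ = 1 := by simpa using z.2
    have hle : ∑ k ∈ Finset.range (n + 1), |a k|
        ≤ ‖∑ k ∈ Finset.range (n + 1), (a k : ℂ) * (z : ℂ) ^ k‖ := by
      rw [← h]
      exact ciSup_le fun w => hz (Set.mem_univ w)
    have hp := pair_eq n a z hz1 (le_antisymm (norm_poly_le n a z hz1) hle)
    have hpos : ∀ k < n, 0 < a k * a (k + 1) * (z : ℂ).re := fun k hk => by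
      rw [← hp k hk]
      exact abs_pos.mpr (mul_ne_zero (ha k (by omega)) (ha (k + 1) (by omega)))
    rcases le_or_gt 0 (z : ℂ).re with hr | hr
    · left
      exact same_sign_of_mul_pos n a (ha 0 (by omega)) fun k hk =>
        pos_of_mul_pos_left (hpos k hk) hr
    · right
      intro k hk
      have := hpos k hk
      by_contra h3
      nlinarith
  · rintro (h | h)
    · exact sup_eq_of_real n a 1 (by simp) (by simpa using h)
    · refine sup_eq_of_real n a (-1) (by simp) ?_
      refine same_sign_of_mul_pos n (fun k => a k * (-1) ^ k) (by simpa using ha 0 (by omega)) ?_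
      intro k hk
      have h1 : a k * (-1) ^ k * (a (k + 1) * (-1) ^ (k + 1))
          = -(a k * a (k + 1)) * ((-1) ^ k * (-1) ^ k) := by ring
      have h2 : ((-1 : ℝ) ^ k * (-1) ^ k) = 1 := by
        rw [← mul_pow]; norm_num
      show 0 < a k * (-1) ^ k * (a (k + 1) * (-1) ^ (k + 1))
      rw [h1, h2]
      linarith [h k hk]
end

section
/- Let 1 < p < ∞, let n ≥ 1 and let a_0, a_1, …, a_n be nonzero real numbers, and set P(z) = Σ_{k=0}^n a_k z^k. Then ‖P(S)‖_{ℓ^p(ℕ)→ℓ^p(ℕ)} = Σ_{k=0}^n |a_k| if and only if either all the a_k have the same sign, or the signs of the a_k are alternating (i.e. a_k·a_{k+1} < 0 for every 0 ≤ k ≤ n−1). -/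
open scoped ENNReal

/-- Scalar Clarkson-type inequality with a constant `C < 2 ^ r`. -/
theorem scalar_clarkson (r : ℝ) (hr : 1 < r) :
    ∃ C : ℝ, 0 ≤ C ∧ C < 2 ^ r ∧ ∀ a b : ℂ,
      ‖a + b‖ ^ r + ‖a - b‖ ^ r ≤ C * (‖a‖ ^ r + ‖b‖ ^ r) := by
  have key : ∀ z : ℂ, ‖z‖ ^ r = (‖z‖ ^ 2) ^ (r / 2) := by
    intro z
    rw [← Real.rpow_natCast, ← Real.rpow_mul (norm_nonneg z)]
    congr 1
    push_cast
    ring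
  rcases le_total (r / 2) 1 with h | h
  · refine ⟨2, by norm_num, ?_, ?_⟩
    · calc (2 : ℝ) = 2 ^ (1 : ℝ) := by simp
        _ < 2 ^ r := Real.rpow_lt_rpow_of_exponent_lt (by norm_num) hr
    · intro a b
      have hpar := parallelogram_law_with_norm ℝ a b
      rw [key, key, key, key]
      set u := ‖a + b‖ ^ 2
      set v := ‖a - b‖ ^ 2
      set A := ‖a‖ ^ 2
      set B := ‖b‖ ^ 2
      have hu : 0 ≤ u := by positivity
      have hv : 0 ≤ v := by positivity
      have hA : 0 ≤ A := by positivity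
      have hB : 0 ≤ B := by positivity
      have h1 := (Real.concaveOn_rpow (p := r / 2) (by linarith) h).2
        (Set.mem_Ici.2 hu) (Set.mem_Ici.2 hv) (by norm_num : (0 : ℝ) ≤ 1 / 2)
        (by norm_num : (0 : ℝ) ≤ 1 / 2) (by norm_num)
      simp only [smul_eq_mul] at h1
      rw [show 1 / 2 * u + 1 / 2 * v = A + B by linarith] at h1
      have h2 := NNReal.rpow_add_le_add_rpow (p := r / 2) ⟨A, hA⟩ ⟨B, hB⟩ (by linarith) h
      have h3 : (A + B) ^ (r / 2) ≤ A ^ (r / 2) + B ^ (r / 2) := by exact_mod_cast h2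
      linarith
  · refine ⟨2 ^ (r - 1), by positivity, ?_, ?_⟩
    · exact Real.rpow_lt_rpow_of_exponent_lt (by norm_num) (by linarith)
    · intro a b
      have hpar := parallelogram_law_with_norm ℝ a b
      rw [key, key, key, key]
      set u := ‖a + b‖ ^ 2
      set v := ‖a - b‖ ^ 2
      set A := ‖a‖ ^ 2
      set B := ‖b‖ ^ 2
      have hu : 0 ≤ u := by positivity
      have hv : 0 ≤ v := by positivity
      have hA : 0 ≤ A := by positivity
      have hB : 0 ≤ B := by positivity
      have h1' := NNReal.add_rpow_le_rpow_add (p := r / 2) ⟨u, hu⟩ ⟨v, hv⟩ h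
      have h1 : u ^ (r / 2) + v ^ (r / 2) ≤ (u + v) ^ (r / 2) := by exact_mod_cast h1'
      have h2' := NNReal.rpow_add_le_mul_rpow_add_rpow (p := r / 2) ⟨A, hA⟩ ⟨B, hB⟩ h
      have h2 : (A + B) ^ (r / 2) ≤ 2 ^ (r / 2 - 1) * (A ^ (r / 2) + B ^ (r / 2)) := by
        exact_mod_cast h2'
      rw [hpar, Real.mul_rpow (by norm_num) (by positivity)] at h1
      have h3 : (2 : ℝ) ^ (r - 1) = 2 ^ (r / 2) * 2 ^ (r / 2 - 1) := by
        rw [← Real.rpow_add (by norm_num)]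
        congr 1
        ring
      rw [h3, mul_assoc]
      exact h1.trans (mul_le_mul_of_nonneg_left h2 (by positivity))

/-- `ℓ^p` is uniformly non-square. -/
theorem lp_nonsquare (p : ℝ≥0∞) [Fact (1 ≤ p)] (hr : 1 < p.toReal) :
    ∃ c : ℝ, 0 ≤ c ∧ c < 2 ∧ ∀ x y : lp (fun _ : ℕ => ℂ) p, ‖y‖ ≤ ‖x‖ →
      ‖x + y‖ ≤ c * ‖x‖ ∨ ‖x - y‖ ≤ c * ‖x‖ := by
  obtain ⟨C, hC0, hC2, hC⟩ := scalar_clarkson p.toReal hr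
  have hr0 : 0 < p.toReal := by linarith
  have hcr : (C ^ (p.toReal)⁻¹) ^ p.toReal = C := Real.rpow_inv_rpow hC0 hr0.ne'
  refine ⟨C ^ (p.toReal)⁻¹, by positivity, ?_, ?_⟩
  · rw [← Real.rpow_lt_rpow_iff (by positivity) (by norm_num) hr0, hcr]
    exact hC2
  · intro x y hxy
    by_contra! hcon
    obtain ⟨h1, h2⟩ := hcon
    have hsum : ‖x + y‖ ^ p.toReal + ‖x - y‖ ^ p.toReal
        ≤ C * (‖x‖ ^ p.toReal + ‖y‖ ^ p.toReal) := by
      refine hasSum_le ?_ ((lp.hasSum_norm hr0 (x + y)).add (lp.hasSum_norm hr0 (x - y)))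
        (((lp.hasSum_norm hr0 x).add (lp.hasSum_norm hr0 y)).mul_left C)
      intro i
      exact hC (x i) (y i)
    have h1' := Real.rpow_lt_rpow (by positivity) h1 hr0
    have h2' := Real.rpow_lt_rpow (by positivity) h2 hr0
    rw [Real.mul_rpow (by positivity) (norm_nonneg _), hcr] at h1' h2'
    have h3 := mul_le_mul_of_nonneg_left
      (Real.rpow_le_rpow (norm_nonneg _) hxy hr0.le) hC0
    linarith

section Shift

variable {p : ℝ≥0∞} [Fact (1 ≤ p)]
  (S : lp (fun _ : ℕ => ℂ) p →L[ℂ] lp (fun _ : ℕ => ℂ) p)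

theorem shift_norm_le (hr : 0 < p.toReal)
    (hS : ∀ (x : lp (fun _ : ℕ => ℂ) p) (j : ℕ),
      (S x : ∀ _ : ℕ, ℂ) j = if j = 0 then 0 else (x : ∀ _ : ℕ, ℂ) (j - 1))
    (x : lp (fun _ : ℕ => ℂ) p) : ‖S x‖ ≤ ‖x‖ := by
  have h1 := lp.hasSum_norm hr x
  have h2 := lp.hasSum_norm hr (S x)
  rw [← hasSum_nat_add_iff' 1] at h2
  have h3 : ∀ i, (S x : ∀ _ : ℕ, ℂ) (i + 1) = x i := by
    intro i
    simp [hS]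
  simp only [h3, Finset.sum_range_one, hS x 0, if_true, norm_zero, Real.zero_rpow hr.ne',
    sub_zero] at h2
  have h4 := h1.unique h2
  exact ((Real.rpow_left_inj (norm_nonneg _) (norm_nonneg _) hr.ne').1 h4).ge

theorem shift_pow_norm_le (hS : ∀ x, ‖S x‖ ≤ ‖x‖) (k : ℕ)
    (x : lp (fun _ : ℕ => ℂ) p) : ‖(S ^ k) x‖ ≤ ‖x‖ := by
  induction k with
  | zero => simp
  | succ k ih =>
    rw [pow_succ']
    exact (hS _).trans ih

theorem shift_pow_apply
    (hS : ∀ (x : lp (fun _ : ℕ => ℂ) p) (j : ℕ),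
      (S x : ∀ _ : ℕ, ℂ) j = if j = 0 then 0 else (x : ∀ _ : ℕ, ℂ) (j - 1))
    (x : lp (fun _ : ℕ => ℂ) p) (k j : ℕ) :
    ((S ^ k) x : ∀ _ : ℕ, ℂ) (j + k) = x j := by
  induction k with
  | zero => simp
  | succ k ih =>
    rw [pow_succ']
    change (S ((S ^ k) x) : ∀ _ : ℕ, ℂ) (j + (k + 1)) = x j
    rw [hS]
    simpa [← add_assoc] using ih

theorem sum_shift_apply (a : ℕ → ℝ) (s : Finset ℕ) (x : lp (fun _ : ℕ => ℂ) p) :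
    (∑ k ∈ s, (a k : ℂ) • (S ^ k)) x = ∑ k ∈ s, (a k : ℂ) • (S ^ k) x := by
  rw [_root_.sum_apply]
  rfl

theorem sum_shift_le (hS : ∀ x, ‖S x‖ ≤ ‖x‖) (a : ℕ → ℝ) (s : Finset ℕ)
    (x : lp (fun _ : ℕ => ℂ) p) :
    ‖∑ k ∈ s, (a k : ℂ) • (S ^ k) x‖ ≤ (∑ k ∈ s, |a k|) * ‖x‖ := by
  rw [Finset.sum_mul]
  refine norm_sum_le_of_le _ fun k _ => ?_
  rw [norm_smul, Complex.norm_real, Real.norm_eq_abs]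
  exact mul_le_mul_of_nonneg_left (shift_pow_norm_le S hS k x) (abs_nonneg _)

/-- Two-term estimate. -/
theorem two_term {E : Type*} [NormedAddCommGroup E] [NormedSpace ℂ E] (x y : E) (hxy : ‖y‖ ≤ ‖x‖)
    (α β m ε : ℝ) (hε : ε = 1 ∨ ε = -1) (hs : 0 < ε * (α * β)) (hmα : m ≤ |α|)
    (hmβ : m ≤ |β|) (hm : 0 ≤ m) :
    ‖(α : ℂ) • x + (β : ℂ) • y‖ ≤ (|α| + |β|) * ‖x‖ - m * (2 * ‖x‖ - ‖x + (ε : ℂ) • y‖) := by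
  obtain ⟨σ, hσ, hα, hβ⟩ : ∃ σ : ℝ, (σ = 1 ∨ σ = -1) ∧ α = σ * |α| ∧ β = σ * ε * |β| := by
    rcases lt_trichotomy α 0 with h | h | h
    · refine ⟨-1, Or.inr rfl, by rw [abs_of_neg h]; ring, ?_⟩
      rcases hε with rfl | rfl
      · have : β < 0 := by nlinarith
        rw [abs_of_neg this]; ring
      · have : 0 < β := by nlinarith
        rw [abs_of_pos this]; ring
    · simp [h] at hs
    · refine ⟨1, Or.inl rfl, by rw [abs_of_pos h]; ring, ?_⟩
      rcases hε with rfl | rfl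
      · have : 0 < β := by nlinarith
        rw [abs_of_pos this]; ring
      · have : β < 0 := by nlinarith
        rw [abs_of_neg this]; ring
  have hσn : ‖(σ : ℂ)‖ = 1 := by rcases hσ with rfl | rfl <;> simp
  have hεn : ‖(ε : ℂ)‖ = 1 := by rcases hε with rfl | rfl <;> simp
  have heq : (α : ℂ) • x + (β : ℂ) • y = (σ : ℂ) • ((m : ℂ) • (x + (ε : ℂ) • y)
      + (((|α| - m : ℝ) : ℂ) • x + ((|β| - m : ℝ) : ℂ) • ((ε : ℂ) • y))) := by
    have hα' : (α : ℂ) = σ * ((|α| : ℝ) : ℂ) := by exact_mod_cast hα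
    have hβ' : (β : ℂ) = σ * ε * ((|β| : ℝ) : ℂ) := by exact_mod_cast hβ
    rw [hα', hβ']
    push_cast
    module
  rw [heq, norm_smul, hσn, one_mul]
  refine (norm_add_le _ _).trans ((add_le_add_right (norm_add_le _ _) _).trans ?_)
  simp only [norm_smul, hεn, one_mul, Complex.norm_real, Real.norm_eq_abs,
    abs_of_nonneg hm, abs_of_nonneg (sub_nonneg.2 hmα), abs_of_nonneg (sub_nonneg.2 hmβ)]
  have := mul_le_mul_of_nonneg_left hxy (sub_nonneg.2 hmβ)
  linarith

theorem poly_le (hS : ∀ x, ‖S x‖ ≤ ‖x‖) (n : ℕ) (a : ℕ → ℝ) (k : ℕ) (hk : k < n)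
    (m ε : ℝ) (hε : ε = 1 ∨ ε = -1) (hs : 0 < ε * (a k * a (k + 1))) (hm : 0 ≤ m)
    (hma : m ≤ |a k|) (hma' : m ≤ |a (k + 1)|) (x : lp (fun _ : ℕ => ℂ) p) :
    ‖∑ i ∈ Finset.range (n + 1), (a i : ℂ) • (S ^ i) x‖ ≤
      (∑ i ∈ Finset.range (n + 1), |a i|) * ‖x‖ - m * (2 * ‖x‖ - ‖x + (ε : ℂ) • S x‖) := by
  have hsub : ({k, k + 1} : Finset ℕ) ⊆ Finset.range (n + 1) := by
    intro i hi
    simp only [Finset.mem_insert, Finset.mem_singleton] at hi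
    rw [Finset.mem_range]
    omega
  rw [← Finset.sum_sdiff hsub, ← Finset.sum_sdiff hsub,
    Finset.sum_pair (by omega), Finset.sum_pair (by omega)]
  have h1 := sum_shift_le S hS a (Finset.range (n + 1) \ {k, k + 1}) x
  have h2 : (a k : ℂ) • (S ^ k) x + (a (k + 1) : ℂ) • (S ^ (k + 1)) x
      = (S ^ k) ((a k : ℂ) • x + (a (k + 1) : ℂ) • S x) := by
    rw [pow_succ, map_add, map_smul, map_smul]
    rfl
  have h3 := two_term x (S x) (hS x) (a k) (a (k + 1)) m ε hε hs hma hma' hm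
  rw [h2]
  refine (norm_add_le _ _).trans ?_
  have h4 := shift_pow_norm_le S hS k ((a k : ℂ) • x + (a (k + 1) : ℂ) • S x)
  linarith

theorem lower_bound (hr : 0 < p.toReal)
    (hS : ∀ (x : lp (fun _ : ℕ => ℂ) p) (j : ℕ),
      (S x : ∀ _ : ℕ, ℂ) j = if j = 0 then 0 else (x : ∀ _ : ℕ, ℂ) (j - 1))
    (n : ℕ) (a : ℕ → ℝ) (σ ε : ℝ) (hσ : σ = 1 ∨ σ = -1) (hε : ε = 1 ∨ ε = -1)
    (ha : ∀ k ≤ n, a k = σ * ε ^ k * |a k|) :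
    ∑ k ∈ Finset.range (n + 1), |a k| ≤ ‖∑ k ∈ Finset.range (n + 1), (a k : ℂ) • (S ^ k)‖ := by
  set A := ∑ k ∈ Finset.range (n + 1), |a k| with hA
  set T := ∑ k ∈ Finset.range (n + 1), (a k : ℂ) • (S ^ k) with hT
  have hA0 : 0 ≤ A := Finset.sum_nonneg fun _ _ => abs_nonneg _
  have hσn : ‖(σ : ℂ)‖ = 1 := by rcases hσ with rfl | rfl <;> simp
  have hεn : ‖(ε : ℂ)‖ = 1 := by rcases hε with rfl | rfl <;> simp
  have hεε : (ε : ℂ) * ε = 1 := by rcases hε with rfl | rfl <;> simp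
  have main : ∀ N : ℕ, (N : ℝ) * A ^ p.toReal ≤ ‖T‖ ^ p.toReal * ((N : ℝ) + n) := by
    intro N
    set x : lp (fun _ : ℕ => ℂ) p :=
      ∑ i ∈ Finset.range (N + n), lp.single p i ((ε : ℂ) ^ i) with hx
    have hxn : ‖x‖ ^ p.toReal = (N : ℝ) + n := by
      rw [hx, lp.norm_sum_single hr (fun i => (ε : ℂ) ^ i)]
      simp only [norm_pow, hεn, one_pow, Real.one_rpow]
      simp
    have hxa : ∀ j < N + n, (x : ∀ _ : ℕ, ℂ) j = (ε : ℂ) ^ j := by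
      intro j hj
      rw [hx, lp.coeFn_sum, Finset.sum_apply, Finset.sum_eq_single j]
      · simp
      · intro i _ hij
        exact lp.single_apply_ne p i _ hij.symm
      · intro h
        exact absurd (Finset.mem_range.2 hj) h
    have hval : ∀ j < N, ‖(T x : ∀ _ : ℕ, ℂ) (j + n)‖ = A := by
      intro j hj
      have hterm : (T x : ∀ _ : ℕ, ℂ) (j + n) = (σ : ℂ) * (ε : ℂ) ^ (j + n) * (A : ℂ) := by
        rw [hT, sum_shift_apply, lp.coeFn_sum, Finset.sum_apply, hA,
          Complex.ofReal_sum, Finset.mul_sum]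
        refine Finset.sum_congr rfl fun k hk => ?_
        have hk' : k ≤ n := by
          have := Finset.mem_range.1 hk
          omega
        have e1 : j + n = (j + (n - k)) + k := by omega
        have e2 : ((S ^ k) x : ∀ _ : ℕ, ℂ) (j + n) = (ε : ℂ) ^ (j + (n - k)) := by
          rw [e1, shift_pow_apply S hS, hxa]
          omega
        have e3 : (a k : ℂ) = σ * (ε : ℂ) ^ k * ((|a k| : ℝ) : ℂ) := by
          exact_mod_cast ha k hk'
        rw [lp.coeFn_smul, Pi.smul_apply, e2, smul_eq_mul, e3]
        conv_rhs => rw [e1, pow_add]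
        ring
      rw [hterm, norm_mul, norm_mul, norm_pow, hσn, hεn, Complex.norm_real, Real.norm_eq_abs,
        abs_of_nonneg hA0]
      simp
    have h1 := lp.sum_rpow_le_norm_rpow hr (T x) ((Finset.range N).map (addRightEmbedding n))
    rw [Finset.sum_map] at h1
    have h2 : ∑ i ∈ Finset.range N,
        ‖(T x : ∀ _ : ℕ, ℂ) (addRightEmbedding n i)‖ ^ p.toReal = N * A ^ p.toReal := by
      rw [Finset.sum_congr rfl (g := fun _ => A ^ p.toReal)]
      · simp
      · intro i hi
        rw [addRightEmbedding_apply, hval i (Finset.mem_range.1 hi)]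
    rw [h2] at h1
    refine h1.trans ?_
    rw [← hxn, ← Real.mul_rpow (norm_nonneg _) (norm_nonneg _)]
    exact Real.rpow_le_rpow (norm_nonneg _) (T.le_opNorm x) hr.le
  rw [← Real.rpow_le_rpow_iff hA0 (norm_nonneg _) hr]
  by_contra! hlt
  obtain ⟨N, hN⟩ := exists_nat_gt (‖T‖ ^ p.toReal * n / (A ^ p.toReal - ‖T‖ ^ p.toReal))
  rw [div_lt_iff₀ (by linarith)] at hN
  have := main N
  linarith

end Shift

/-- Let `1 < p < ∞`, let `n ≥ 1` and let `a_0, …, a_n` be nonzero real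
numbers, and set `P(z) = Σ_{k=0}^n a_k z^k`.  Then `‖P(S)‖_{ℓ^p(ℕ)→ℓ^p(ℕ)} = Σ_{k=0}^n |a_k|`
if and only if either all the `a_k` have the same sign, or the signs of the `a_k` are
alternating.  Here `S` is the right shift on `ℓ^p(ℕ)`. -/
theorem shift_norm_eq_sum_abs_iff (p : ℝ≥0∞) [Fact (1 ≤ p)] (hp : 1 < p) (hp' : p ≠ ∞)
    (n : ℕ) (hn : 1 ≤ n) (a : ℕ → ℝ) (ha : ∀ k ≤ n, a k ≠ 0)
    (S : lp (fun _ : ℕ => ℂ) p →L[ℂ] lp (fun _ : ℕ => ℂ) p)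
    (hS : ∀ (x : lp (fun _ : ℕ => ℂ) p) (j : ℕ),
      (S x : ∀ _ : ℕ, ℂ) j = if j = 0 then 0 else (x : ∀ _ : ℕ, ℂ) (j - 1)) :
    ‖∑ k ∈ Finset.range (n + 1), (a k : ℂ) • (S ^ k)‖
      = ∑ k ∈ Finset.range (n + 1), |a k| ↔
    (((∀ k ≤ n, 0 < a k) ∨ (∀ k ≤ n, a k < 0)) ∨
      (∀ k < n, a k * a (k + 1) < 0)) := by
  have hr : 1 < p.toReal := by
    have := (ENNReal.toReal_lt_toReal ENNReal.one_ne_top hp').2 hp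
    simpa using this
  have hr0 : 0 < p.toReal := by linarith
  have hSn : ∀ x, ‖S x‖ ≤ ‖x‖ := shift_norm_le S hr0 hS
  constructor
  · intro hnorm
    by_contra! hcon
    obtain ⟨⟨hnp, hnn⟩, k, hk, hk0⟩ := hcon
    have hk1 : 0 < 1 * (a k * a (k + 1)) := by
      rw [one_mul]
      exact lt_of_le_of_ne hk0 (mul_ne_zero (ha k hk.le) (ha (k + 1) hk)).symm
    obtain ⟨l, hl, hl0⟩ : ∃ l < n, a l * a (l + 1) < 0 := by
      by_contra! hall
      have hstep : ∀ i ≤ n, 0 < a 0 * a i := by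
        intro i
        induction i with
        | zero => intro _; exact mul_self_pos.2 (ha 0 (Nat.zero_le _))
        | succ i ih =>
          intro hi
          have h1 := ih (by omega)
          have h2 := lt_of_le_of_ne (hall i (by omega))
            (mul_ne_zero (ha i (by omega)) (ha (i + 1) hi)).symm
          have h3 := mul_pos h1 h2
          have h4 : 0 < a i * a i := mul_self_pos.2 (ha i (by omega))
          by_contra! h5
          nlinarith
      obtain ⟨i, hi, hi'⟩ := hnp
      obtain ⟨j, hj, hj'⟩ := hnn
      have h1 := hstep i hi
      have h2 := hstep j hj
      rcases lt_or_ge 0 (a 0) with h | h <;> nlinarith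
    have hl1 : 0 < (-1) * (a l * a (l + 1)) := by linarith
    obtain ⟨c, hc0, hc2, hc⟩ := lp_nonsquare p hr
    set m := min (min |a k| |a (k + 1)|) (min |a l| |a (l + 1)|) with hm
    have hm0 : 0 < m := by
      refine lt_min (lt_min ?_ ?_) (lt_min ?_ ?_) <;> exact abs_pos.2 (ha _ (by omega))
    set A := ∑ k ∈ Finset.range (n + 1), |a k| with hA
    have hmA : 2 * m ≤ A := by
      have h1 : ∑ i ∈ ({k, k + 1} : Finset ℕ), |a i| ≤ A := by
        refine Finset.sum_le_sum_of_subset_of_nonneg ?_ fun _ _ _ => abs_nonneg _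
        intro i hi
        simp only [Finset.mem_insert, Finset.mem_singleton] at hi
        rw [Finset.mem_range]
        omega
      rw [Finset.sum_pair (by omega)] at h1
      have h2 : m ≤ |a k| := (min_le_left _ _).trans (min_le_left _ _)
      have h3 : m ≤ |a (k + 1)| := (min_le_left _ _).trans (min_le_right _ _)
      linarith
    have hbound : ‖∑ k ∈ Finset.range (n + 1), (a k : ℂ) • (S ^ k)‖ ≤ A - m * (2 - c) := by
      refine ContinuousLinearMap.opNorm_le_bound _ (by nlinarith) fun x => ?_
      rw [sum_shift_apply]
      rcases hc x (S x) (hSn x) with h | h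
      · have h1 := poly_le S hSn n a k hk m 1 (Or.inl rfl) hk1 hm0.le
          ((min_le_left _ _).trans (min_le_left _ _))
          ((min_le_left _ _).trans (min_le_right _ _)) x
        rw [Complex.ofReal_one, one_smul] at h1
        have := mul_le_mul_of_nonneg_left h hm0.le
        linarith
      · have h1 := poly_le S hSn n a l hl m (-1) (Or.inr rfl) hl1 hm0.le
          ((min_le_right _ _).trans (min_le_left _ _))
          ((min_le_right _ _).trans (min_le_right _ _)) x
        rw [Complex.ofReal_neg, Complex.ofReal_one, neg_one_smul, ← sub_eq_add_neg] at h1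
        have := mul_le_mul_of_nonneg_left h hm0.le
        linarith
    rw [hnorm] at hbound
    have : 0 < m * (2 - c) := mul_pos hm0 (by linarith)
    linarith
  · intro hcase
    refine le_antisymm ?_ ?_
    · refine ContinuousLinearMap.opNorm_le_bound _
        (Finset.sum_nonneg fun _ _ => abs_nonneg _) fun x => ?_
      rw [sum_shift_apply]
      exact sum_shift_le S hSn a _ x
    · rcases hcase with (h | h) | h
      · refine lower_bound S hr0 hS n a 1 1 (Or.inl rfl) (Or.inl rfl) fun k hk => ?_
        rw [abs_of_pos (h k hk)]
        simp
      · refine lower_bound S hr0 hS n a (-1) 1 (Or.inr rfl) (Or.inl rfl) fun k hk => ?_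
        rw [abs_of_neg (h k hk)]
        simp
      · obtain ⟨σ, hσ, h0⟩ : ∃ σ : ℝ, (σ = 1 ∨ σ = -1) ∧ a 0 = σ * |a 0| := by
          rcases le_total 0 (a 0) with h0 | h0
          · exact ⟨1, Or.inl rfl, by rw [abs_of_nonneg h0]; ring⟩
          · exact ⟨-1, Or.inr rfl, by rw [abs_of_nonpos h0]; ring⟩
        refine lower_bound S hr0 hS n a σ (-1) hσ (Or.inr rfl) fun k => ?_
        induction k with
        | zero => intro _; simpa using h0
        | succ k ih =>
          intro hk
          have h1 := ih (by omega)
          have h2 := h k (by omega)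
          have h3 : σ * (-1) ^ k = 1 ∨ σ * (-1) ^ k = -1 := by
            rcases hσ with rfl | rfl <;> rcases neg_one_pow_eq_or ℝ k with h | h <;> simp [h]
          have h4 : σ * (-1) ^ (k + 1) = -(σ * (-1) ^ k) := by ring
          have h5 : 0 < |a k| := abs_pos.2 (ha k (by omega))
          rw [h4]
          rcases h3 with h3 | h3
          · rw [h3] at h1 ⊢
            have : a (k + 1) < 0 := by nlinarith
            rw [abs_of_neg this]
            ring
          · rw [h3] at h1 ⊢
            have : 0 < a (k + 1) := by nlinarith
            rw [abs_of_pos this]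
            ring
end

section
/- Let 1 ≤ p ≤ ∞ and let a, b be complex numbers. Then the operator norm of a·Id + b·S on ℓ^p(ℕ) equals |a| + |b|. -/
open scoped ENNReal

lemma exists_phase_aux (a b : ℂ) : ∃ w : ℂ, ‖w‖ = 1 ∧ ‖a * w + b‖ = ‖a‖ + ‖b‖ := by
  refine ⟨Complex.exp (((b.arg - a.arg : ℝ) : ℂ) * Complex.I), Complex.norm_exp_ofReal_mul_I _, ?_⟩
  have h1 : a * Complex.exp (((b.arg - a.arg : ℝ) : ℂ) * Complex.I)
      = ‖a‖ * Complex.exp (b.arg * Complex.I) := by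
    conv_lhs => rw [← Complex.norm_mul_exp_arg_mul_I a]
    rw [mul_assoc, ← Complex.exp_add]
    simp only [Complex.norm_mul_exp_arg_mul_I]
    congr 2
    push_cast
    ring
  have h2 : a * Complex.exp (((b.arg - a.arg : ℝ) : ℂ) * Complex.I) + b
      = ((‖a‖ + ‖b‖ : ℝ) : ℂ) * Complex.exp (b.arg * Complex.I) := by
    rw [h1]
    push_cast
    rw [add_mul, Complex.norm_mul_exp_arg_mul_I b]
  rw [h2, norm_mul, Complex.norm_exp_ofReal_mul_I, mul_one, Complex.norm_real, Real.norm_of_nonneg]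
  positivity

/-- Let `1 ≤ p ≤ ∞` and let `a, b` be complex numbers.  Then the operator
norm of `a·Id + b·S` on `ℓ^p(ℕ)` equals `|a| + |b|`, where `S` is the right shift. -/
theorem norm_affine_shift (p : ℝ≥0∞) [Fact (1 ≤ p)] (a b : ℂ)
    (S : lp (fun _ : ℕ => ℂ) p →L[ℂ] lp (fun _ : ℕ => ℂ) p)
    (hS : ∀ (x : lp (fun _ : ℕ => ℂ) p) (j : ℕ),
      (S x : ∀ _ : ℕ, ℂ) j = if j = 0 then 0 else (x : ∀ _ : ℕ, ℂ) (j - 1)) :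
    ‖a • (1 : lp (fun _ : ℕ => ℂ) p →L[ℂ] lp (fun _ : ℕ => ℂ) p) + b • S‖ = ‖a‖ + ‖b‖ := by
  have hp1 : 1 ≤ p := Fact.out
  have hS1 : ‖S‖ ≤ 1 := by
    refine ContinuousLinearMap.opNorm_le_bound _ zero_le_one fun x => ?_
    rw [one_mul]
    rcases eq_or_ne p ∞ with rfl | hp
    · refine lp.norm_le_of_forall_le (norm_nonneg _) fun j => ?_
      rw [hS]
      split_ifs
      · simp
      · exact lp.norm_apply_le_norm ENNReal.top_ne_zero x _
    · have hpos : 0 < p.toReal := ENNReal.toReal_pos (by positivity) hp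
      have : ‖S x‖ ^ p.toReal = ‖x‖ ^ p.toReal := by
        rw [lp.norm_rpow_eq_tsum hpos, lp.norm_rpow_eq_tsum hpos,
          ((lp.memℓp (S x)).summable hpos).tsum_eq_zero_add]
        simp [hS, Real.zero_rpow hpos.ne']
      exact (Real.rpow_le_rpow_iff (norm_nonneg _) (norm_nonneg _) hpos).1 this.le
  obtain ⟨w, hw, hab⟩ := exists_phase_aux a b
  set T := a • (1 : lp (fun _ : ℕ => ℂ) p →L[ℂ] lp (fun _ : ℕ => ℂ) p) + b • S with hT
  have hTx : ∀ (x : lp (fun _ : ℕ => ℂ) p) (j : ℕ),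
      (T x : ∀ _ : ℕ, ℂ) (j + 1) = a * (x : ∀ _ : ℕ, ℂ) (j + 1) + b * (x : ∀ _ : ℕ, ℂ) j := by
    intro x j
    change a * (x : ∀ _ : ℕ, ℂ) (j + 1) + b * (S x : ∀ _ : ℕ, ℂ) (j + 1) = _
    rw [hS]
    simp
  have hval : ∀ j : ℕ, ‖a * w ^ (j + 1) + b * w ^ j‖ = ‖a‖ + ‖b‖ := by
    intro j
    rw [show a * w ^ (j + 1) + b * w ^ j = (a * w + b) * w ^ j by ring, norm_mul, norm_pow, hw,
      one_pow, mul_one, hab]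
  apply le_antisymm
  · have hone : ‖(1 : lp (fun _ : ℕ => ℂ) p →L[ℂ] lp (fun _ : ℕ => ℂ) p)‖ ≤ 1 :=
      ContinuousLinearMap.norm_id_le
    calc ‖T‖ ≤ ‖a‖ * ‖(1 : lp (fun _ : ℕ => ℂ) p →L[ℂ] lp (fun _ : ℕ => ℂ) p)‖ + ‖b‖ * ‖S‖ := by
          refine (norm_add_le _ _).trans ?_
          rw [norm_smul, norm_smul]
      _ ≤ ‖a‖ * 1 + ‖b‖ * 1 := by gcongr
      _ = _ := by ring
  · rcases eq_or_ne p ∞ with rfl | hp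
    · have hmem : Memℓp (fun j : ℕ => w ^ j) ∞ := by
        refine memℓp_infty ⟨1, ?_⟩
        rintro _ ⟨j, rfl⟩
        simp [hw]
      let x : lp (fun _ : ℕ => ℂ) ∞ := ⟨_, hmem⟩
      have hx : ‖x‖ ≤ 1 := by
        refine lp.norm_le_of_forall_le zero_le_one fun j => ?_
        change ‖w ^ j‖ ≤ 1
        simp [hw]
      have h1 := lp.norm_apply_le_norm ENNReal.top_ne_zero (T x) (0 + 1)
      rw [hTx] at h1
      change ‖a * w ^ (0 + 1) + b * w ^ 0‖ ≤ _ at h1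
      rw [hval] at h1
      exact h1.trans (T.unit_le_opNorm x hx)
    · have hpos : 0 < p.toReal := ENNReal.toReal_pos (by positivity) hp
      rw [← Real.rpow_le_rpow_iff (by positivity) (norm_nonneg _) hpos]
      have key : ∀ n : ℕ, (n : ℝ) * (‖a‖ + ‖b‖) ^ p.toReal ≤ ‖T‖ ^ p.toReal * (n + 1) := by
        intro n
        let x : lp (fun _ : ℕ => ℂ) p :=
          ∑ i ∈ Finset.range (n + 1), lp.single p i (w ^ i)
        have hx : ‖x‖ ^ p.toReal = n + 1 := by
          have := lp.norm_sum_single (E := fun _ : ℕ => ℂ) hpos (fun i => w ^ i)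
            (Finset.range (n + 1))
          rw [this]
          simp [hw]
        have hxj : ∀ j, j ≤ n → (x : ∀ _ : ℕ, ℂ) j = w ^ j := by
          intro j hj
          simp only [x, lp.coeFn_sum, Finset.sum_apply, lp.coeFn_single, Pi.single_apply]
          simp
          omega
        have h1 := lp.sum_rpow_le_norm_rpow hpos (T x) ((Finset.range n).image (· + 1))
        rw [Finset.sum_image (by simp)] at h1
        have h2 : ∑ j ∈ Finset.range n, ‖(T x : ∀ _ : ℕ, ℂ) (j + 1)‖ ^ p.toReal
            = n * (‖a‖ + ‖b‖) ^ p.toReal := by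
          rw [Finset.sum_congr rfl (g := fun _ => (‖a‖ + ‖b‖) ^ p.toReal)]
          · simp
          · intro j hj
            have := Finset.mem_range.1 hj
            rw [hTx, hxj _ (by omega), hxj _ (by omega), hval]
        rw [h2] at h1
        refine h1.trans ?_
        rw [← hx, ← Real.mul_rpow (norm_nonneg _) (norm_nonneg _)]
        exact Real.rpow_le_rpow (norm_nonneg _) (T.le_opNorm x) hpos.le
      by_contra! hlt
      obtain ⟨n, hn⟩ := exists_nat_gt
        (‖T‖ ^ p.toReal / ((‖a‖ + ‖b‖) ^ p.toReal - ‖T‖ ^ p.toReal))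
      rw [div_lt_iff₀ (sub_pos.2 hlt)] at hn
      linarith [key n]
end

section
/- Let 1 ≤ p < ∞, let b : ℝ → ℂ be continuous with compact support, and let n ≥ 1 be an integer. For u ∈ ℓ^p(ℤ), one has 𝔼_n(C_b(J_n u)) = J_n(C_{a_n} u) almost everywhere on ℝ, where a_n = (a_{n,k})_{k∈ℤ}. -/
open scoped ENNReal
open MeasureTheory

/-- The coefficients `a_{n,k} = ∫₀¹∫₀¹ (1/n)·b((t−s+k)/n) ds dt`. -/
noncomputable def discreteCoeff (b : ℝ → ℂ) (n : ℕ) (k : ℤ) : ℂ :=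
  ∫ t in (0:ℝ)..1, ∫ s in (0:ℝ)..1, (1 / (n : ℂ)) * b ((t - s + (k : ℝ)) / n)

/-- The isometric embedding `J_n : ℓ^p(ℤ) → L^p(ℝ)`,
`J_n(u) = n^{1/p} Σ_k u_k 1_{[k/n,(k+1)/n)}`, described pointwise. -/
noncomputable def Jmap (p : ℝ≥0∞) (n : ℕ) (v : ℤ → ℂ) (s : ℝ) : ℂ :=
  ((n : ℝ) ^ (1 / p.toReal) : ℝ) * v ⌊(n : ℝ) * s⌋

/-- The conditional expectation `𝔼_n` with respect to the σ-algebra generated by the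
intervals `[k/n, (k+1)/n)`, `k ∈ ℤ`, described pointwise. -/
noncomputable def condExpDyadic (n : ℕ) (f : ℝ → ℂ) (s : ℝ) : ℂ :=
  (n : ℂ) * ∫ t in Set.Ico ((⌊(n : ℝ) * s⌋ : ℝ) / n) (((⌊(n : ℝ) * s⌋ : ℝ) + 1) / n), f t

/-- The convolution operator `C_b`, `(C_b f)(s) = ∫_ℝ b(t) f(s−t) dt`. -/
noncomputable def convOp (b : ℝ → ℂ) (f : ℝ → ℂ) (s : ℝ) : ℂ :=
  ∫ t : ℝ, b t * f (s - t)

lemma aux_coeff (b : ℝ → ℂ) (n : ℕ) (hn : 1 ≤ n) (k j : ℤ) :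
    discreteCoeff b n (k - j) = (n : ℂ) * ∫ x in ((k : ℝ) / n)..(((k : ℝ) + 1) / n),
      ∫ y in ((j : ℝ) / n)..(((j : ℝ) + 1) / n), b (x - y) := by
  have hn0 : (n : ℝ) ≠ 0 := by positivity
  have hn1 : (n : ℂ) ≠ 0 := by exact_mod_cast hn0
  unfold discreteCoeff
  have h1 : ∀ t : ℝ, (∫ s in (0:ℝ)..1, (1 / (n : ℂ)) * b ((t - s + ((k - j : ℤ) : ℝ)) / n))
      = ∫ y in ((j : ℝ) / n)..(((j : ℝ) + 1) / n), b ((t / n + (k : ℝ) / n) - y) := by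
    intro t
    rw [intervalIntegral.integral_const_mul]
    have h := intervalIntegral.integral_comp_div_add (a := 0) (b := 1)
      (fun y => b ((t / n + (k : ℝ) / n) - y)) hn0 ((j : ℝ) / n)
    have e1 : (0 : ℝ) / n + (j : ℝ) / n = (j : ℝ) / n := by ring
    have e2 : (1 : ℝ) / n + (j : ℝ) / n = ((j : ℝ) + 1) / n := by ring
    rw [e1, e2] at h
    have e3 : ∀ s : ℝ, (t - s + ((k - j : ℤ) : ℝ)) / n
        = (t / n + (k : ℝ) / n) - (s / n + (j : ℝ) / n) := by
      intro s; push_cast; ring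
    simp only [e3]
    rw [h, Complex.real_smul, ← mul_assoc]
    push_cast
    rw [one_div_mul_cancel hn1, one_mul]
  simp only [h1]
  have h := intervalIntegral.integral_comp_div_add (a := 0) (b := 1)
      (fun x => ∫ y in ((j : ℝ) / n)..(((j : ℝ) + 1) / n), b (x - y)) hn0 ((k : ℝ) / n)
  have e1 : (0 : ℝ) / n + (k : ℝ) / n = (k : ℝ) / n := by ring
  have e2 : (1 : ℝ) / n + (k : ℝ) / n = ((k : ℝ) + 1) / n := by ring
  rw [e1, e2] at h
  rw [h, Complex.real_smul]
  push_cast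
  rfl

lemma aux_floor (n : ℕ) (hn : 1 ≤ n) (y : ℝ) (j : ℤ) :
    y ∈ Set.Ico ((j : ℝ) / n) (((j : ℝ) + 1) / n) ↔ ⌊(n : ℝ) * y⌋ = j := by
  have hn0 : (0 : ℝ) < n := by positivity
  rw [Int.floor_eq_iff, Set.mem_Ico, div_le_iff₀ hn0, lt_div_iff₀ hn0, mul_comm y]

lemma aux_main (b : ℝ → ℂ) (hb : Continuous b) (hb' : HasCompactSupport b)
    (n : ℕ) (hn : 1 ≤ n) (c : ℂ) (u : ℤ → ℂ) (k : ℤ) :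
    (n : ℂ) * ∫ x in Set.Ico ((k : ℝ) / n) (((k : ℝ) + 1) / n),
        convOp b (fun s => c * u ⌊(n : ℝ) * s⌋) x
      = c * ∑' j : ℤ, discreteCoeff b n (k - j) * u j := by
  have hn0 : (0 : ℝ) < n := by positivity
  obtain ⟨R, hR⟩ : ∃ R : ℝ, ∀ x, R < |x| → b x = 0 := by
    obtain ⟨R, hR⟩ := hb'.isCompact.isBounded.exists_norm_le
    refine ⟨R, fun x hx => ?_⟩
    by_contra h
    have := hR x (subset_tsupport b h)
    rw [Real.norm_eq_abs] at this
    linarith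
  obtain ⟨M, hM⟩ : ∃ M : ℤ, (n : ℝ) * R + 2 ≤ M := ⟨_, Int.le_ceil _⟩
  have hvan : ∀ j : ℤ, j ∉ Finset.Icc (k - M) (k + M) → ∀ x y : ℝ,
      x ∈ Set.Icc ((k : ℝ) / n) (((k : ℝ) + 1) / n) →
      y ∈ Set.Icc ((j : ℝ) / n) (((j : ℝ) + 1) / n) → b (x - y) = 0 := by
    intro j hj x y hx hy
    apply hR
    obtain ⟨hx1, hx2⟩ := hx
    obtain ⟨hy1, hy2⟩ := hy
    rw [div_le_iff₀ hn0] at hx1 hy1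
    rw [le_div_iff₀ hn0] at hx2 hy2
    rw [Finset.mem_Icc, not_and_or, not_le, not_le] at hj
    rw [lt_abs]
    rcases hj with hj | hj
    · left
      have : (j : ℝ) + 1 ≤ k - M := by exact_mod_cast hj
      nlinarith
    · right
      have : (k : ℝ) + M + 1 ≤ j := by exact_mod_cast hj
      nlinarith
  have hle : ∀ j : ℤ, (j : ℝ) / n ≤ ((j : ℝ) + 1) / n := fun j => by gcongr; linarith
  have hG : ∀ j : ℤ, Continuous
      (fun x : ℝ => ∫ y in ((j : ℝ) / n)..(((j : ℝ) + 1) / n), b (x - y)) := fun j =>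
    intervalIntegral.continuous_parametric_intervalIntegral_of_continuous' (by fun_prop) _ _
  have hconv : ∀ x ∈ Set.Ico ((k : ℝ) / n) (((k : ℝ) + 1) / n),
      convOp b (fun s => c * u ⌊(n : ℝ) * s⌋) x = ∑ j ∈ Finset.Icc (k - M) (k + M),
        (c * u j) * ∫ y in ((j : ℝ) / n)..(((j : ℝ) + 1) / n), b (x - y) := by
    intro x hx
    have h1 : convOp b (fun s => c * u ⌊(n : ℝ) * s⌋) x
        = ∫ y, b (x - y) * (c * u ⌊(n : ℝ) * y⌋) := by
      unfold convOp
      rw [← integral_sub_left_eq_self (fun y => b (x - y) * (c * u ⌊(n : ℝ) * y⌋)) volume x]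
      simp
    have h2 : ∀ y, b (x - y) * (c * u ⌊(n : ℝ) * y⌋) = ∑ j ∈ Finset.Icc (k - M) (k + M),
        (Set.Ico ((j : ℝ) / n) (((j : ℝ) + 1) / n)).indicator
          (fun y => (c * u j) * b (x - y)) y := by
      intro y
      simp only [Set.indicator_apply, aux_floor n hn]
      rw [Finset.sum_ite_eq]
      split_ifs with h
      · ring
      · rw [hvan _ h x y (Set.Ico_subset_Icc_self hx)
          (Set.Ico_subset_Icc_self ((aux_floor n hn y _).2 rfl)), zero_mul]
    rw [h1]
    simp only [h2]
    rw [integral_finset_sum]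
    · refine Finset.sum_congr rfl fun j _ => ?_
      rw [integral_indicator measurableSet_Ico, integral_const_mul,
        intervalIntegral.integral_of_le (hle j), integral_Ico_eq_integral_Ioc]
    · intro j _
      rw [integrable_indicator_iff measurableSet_Ico]
      refine (ContinuousOn.integrableOn_Icc ?_).mono_set Set.Ico_subset_Icc_self
      fun_prop
  rw [setIntegral_congr_fun measurableSet_Ico hconv, integral_Ico_eq_integral_Ioc,
    ← intervalIntegral.integral_of_le (hle k), intervalIntegral.integral_finset_sum]
  · rw [tsum_eq_sum (s := Finset.Icc (k - M) (k + M)), Finset.mul_sum, Finset.mul_sum]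
    · refine Finset.sum_congr rfl fun j _ => ?_
      rw [intervalIntegral.integral_const_mul, aux_coeff b n hn]
      ring
    · intro j hj
      rw [aux_coeff b n hn]
      have : (∫ x in ((k : ℝ) / n)..(((k : ℝ) + 1) / n),
          ∫ y in ((j : ℝ) / n)..(((j : ℝ) + 1) / n), b (x - y))
          = ∫ x in ((k : ℝ) / n)..(((k : ℝ) + 1) / n), (0 : ℂ) := by
        refine intervalIntegral.integral_congr fun x hx => ?_
        rw [Set.uIcc_of_le (hle k)] at hx
        have : (∫ y in ((j : ℝ) / n)..(((j : ℝ) + 1) / n), b (x - y))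
            = ∫ y in ((j : ℝ) / n)..(((j : ℝ) + 1) / n), (0 : ℂ) := by
          refine intervalIntegral.integral_congr fun y hy => ?_
          rw [Set.uIcc_of_le (hle j)] at hy
          exact hvan j hj x y hx hy
        simpa using this
      rw [this]
      simp
  · intro j _
    exact (continuous_const.mul (hG j)).intervalIntegrable _ _

/-- Let `1 ≤ p < ∞`, let `b : ℝ → ℂ` be continuous with compact support,
and let `n ≥ 1`.  For `u ∈ ℓ^p(ℤ)`, one has `𝔼_n(C_b(J_n u)) = J_n(C_{a_n} u)` almost
everywhere on `ℝ`. -/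
theorem condExp_conv_eq_discrete_conv (p : ℝ≥0∞) [Fact (1 ≤ p)] (hp : p ≠ ∞)
    (b : ℝ → ℂ) (hb : Continuous b) (hb' : HasCompactSupport b)
    (n : ℕ) (hn : 1 ≤ n) (u : lp (fun _ : ℤ => ℂ) p) :
    ∀ᵐ s : ℝ, condExpDyadic n (convOp b (Jmap p n (u : ∀ _ : ℤ, ℂ))) s
      = Jmap p n (fun k => ∑' j : ℤ, discreteCoeff b n (k - j) * (u : ∀ _ : ℤ, ℂ) j) s := by
  exact Filter.Eventually.of_forall fun s =>
    aux_main b hb hb' n hn _ (u : ∀ _ : ℤ, ℂ) ⌊(n : ℝ) * s⌋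
end

section
/- Let 1 ≤ p < ∞, let Y be a complex Banach space, let b : ℝ → ℂ be continuous with compact support, and let n ≥ 1 be an integer. Then the operator norm of C_{a_n}⊗Id_Y on ℓ^p(ℤ;Y) is at most the operator norm of C_b⊗Id_Y on the Bochner space L^p(ℝ;Y), where a_n = (a_{n,k})_{k∈ℤ}. -/
open scoped ENNReal
open MeasureTheory

/-- The cells `[k/n, (k+1)/n)`. -/
def gridCell (n : ℕ) (k : ℤ) : Set ℝ := Set.Ico ((k : ℝ) / n) (((k : ℝ) + 1) / n)

lemma mem_gridCell {n : ℕ} (hn : 1 ≤ n) (k : ℤ) (x : ℝ) :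
    x ∈ gridCell n k ↔ ⌊(n : ℝ) * x⌋ = k := by
  have hn0 : (0 : ℝ) < n := by exact_mod_cast hn
  rw [Int.floor_eq_iff, gridCell, Set.mem_Ico, div_le_iff₀ hn0, lt_div_iff₀ hn0, mul_comm x]

lemma measurableSet_gridCell (n : ℕ) (k : ℤ) : MeasurableSet (gridCell n k) :=
  measurableSet_Ico

lemma volume_gridCell {n : ℕ} (hn : 1 ≤ n) (k : ℤ) : volume (gridCell n k) = (n : ℝ≥0∞)⁻¹ := by
  have hn0 : (0 : ℝ) < n := by exact_mod_cast hn
  rw [gridCell, Real.volume_Ico, ← sub_div, add_sub_cancel_left, one_div,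
    ENNReal.ofReal_inv_of_pos hn0, ENNReal.ofReal_natCast]

lemma disjoint_gridCell {n : ℕ} (hn : 1 ≤ n) :
    Pairwise (Function.onFun Disjoint (gridCell n)) := by
  intro i j hij
  refine Set.disjoint_left.2 fun x hi hj => hij ?_
  rw [← (mem_gridCell hn i x).1 hi, (mem_gridCell hn j x).1 hj]

lemma iUnion_gridCell {n : ℕ} (hn : 1 ≤ n) : (⋃ k, gridCell n k) = Set.univ :=
  Set.eq_univ_of_forall fun x => Set.mem_iUnion.2 ⟨_, (mem_gridCell hn _ x).2 rfl⟩

lemma lintegral_eq_tsum_gridCell {n : ℕ} (hn : 1 ≤ n) (h : ℝ → ℝ≥0∞) :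
    ∫⁻ x, h x = ∑' k : ℤ, ∫⁻ x in gridCell n k, h x := by
  rw [← lintegral_iUnion (measurableSet_gridCell n) (disjoint_gridCell hn), iUnion_gridCell hn,
    Measure.restrict_univ]

lemma lintegral_step {n : ℕ} (hn : 1 ≤ n) (g : ℤ → ℝ≥0∞) :
    ∫⁻ x : ℝ, g ⌊(n : ℝ) * x⌋ = (n : ℝ≥0∞)⁻¹ * ∑' k : ℤ, g k := by
  rw [lintegral_eq_tsum_gridCell hn, ← ENNReal.tsum_mul_left]
  congr 1
  ext k
  rw [setLIntegral_congr_fun (g := fun _ => g k) (measurableSet_gridCell n k)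
    (fun x hx => by simp only [(mem_gridCell hn k x).1 hx])]
  rw [setLIntegral_const, volume_gridCell hn, mul_comm]

lemma setIntegral_gridCell {E : Type*} [NormedAddCommGroup E] [NormedSpace ℝ E]
    {n : ℕ} (hn : 1 ≤ n) (k : ℤ) (h : ℝ → E) :
    ∫ x in gridCell n k, h x = (n : ℝ)⁻¹ • ∫ t in (0 : ℝ)..1, h ((n : ℝ)⁻¹ * t + k / n) := by
  have hn0 : (0 : ℝ) < n := by exact_mod_cast hn
  rw [intervalIntegral.integral_comp_mul_add h (inv_ne_zero hn0.ne'), inv_inv, smul_smul,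
    inv_mul_cancel₀ hn0.ne', one_smul, gridCell, MeasureTheory.integral_Ico_eq_integral_Ioc,
    ← intervalIntegral.integral_of_le (by gcongr; linarith)]
  congr 1 <;> ring

lemma discreteCoeff_eq {n : ℕ} (hn : 1 ≤ n) (b : ℝ → ℂ) (k j : ℤ) :
    discreteCoeff b n (k - j)
      = (n : ℂ) * ∫ s in gridCell n k, ∫ x in gridCell n j, b (s - x) := by
  have hn0 : (n : ℂ) ≠ 0 := by exact_mod_cast (by omega : n ≠ 0)
  simp_rw [setIntegral_gridCell hn, discreteCoeff]
  rw [intervalIntegral.integral_smul]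
  simp only [intervalIntegral.integral_const_mul, Complex.real_smul]
  push_cast
  rw [mul_inv_cancel_left₀ hn0, one_div]
  congr 2
  ext t
  congr 1
  ext s
  congr 1
  ring

lemma jensen_gridCell {Y : Type*} [NormedAddCommGroup Y] [NormedSpace ℂ Y]
    {p : ℝ≥0∞} (hp1 : 1 ≤ p) (hp : p ≠ ∞) {n : ℕ} (hn : 1 ≤ n) (k : ℤ) (G : ℝ → Y)
    (hG : AEStronglyMeasurable G volume) :
    ‖(n : ℂ) • ∫ s in gridCell n k, G s‖ₑ ^ p.toReal
      ≤ n * ∫⁻ s in gridCell n k, ‖G s‖ₑ ^ p.toReal := by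
  have hn0 : (n : ℝ≥0∞) ≠ 0 := by exact_mod_cast (by omega : n ≠ 0)
  have hq : 1 ≤ p.toReal := by simpa using ENNReal.toReal_mono hp hp1
  have hq0 : 0 < p.toReal := by linarith
  have h1 := eLpNorm_le_eLpNorm_mul_rpow_measure_univ (μ := volume.restrict (gridCell n k))
    hp1 hG.restrict
  rw [eLpNorm_one_eq_lintegral_enorm, eLpNorm_eq_lintegral_rpow_enorm_toReal
    (zero_lt_one.trans_le hp1).ne' hp, Measure.restrict_apply_univ, volume_gridCell hn] at h1
  have h2 := (enorm_integral_le_lintegral_enorm (μ := volume.restrict (gridCell n k)) G).trans h1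
  have hcn : ‖(n : ℂ)‖ₑ = n := by
    rw [← ofReal_norm, Complex.norm_natCast, ENNReal.ofReal_natCast]
  rw [enorm_smul, hcn]
  refine (ENNReal.rpow_le_rpow (mul_le_mul_right h2 _) hq0.le).trans (le_of_eq ?_)
  rw [ENNReal.mul_rpow_of_nonneg _ _ hq0.le, ENNReal.mul_rpow_of_nonneg _ _ hq0.le,
    ← ENNReal.rpow_mul, ← ENNReal.rpow_mul, one_div_mul_cancel hq0.ne', ENNReal.rpow_one,
    mul_left_comm, mul_comm]
  congr 1
  rw [ENNReal.inv_rpow, ← ENNReal.rpow_neg, ← ENNReal.rpow_add _ _ hn0 (ENNReal.natCast_ne_top n)]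
  convert ENNReal.rpow_one _
  simp
  field_simp
  ring

lemma hasSum_gridCell {Y : Type*} [NormedAddCommGroup Y] [NormedSpace ℂ Y] [CompleteSpace Y]
    (b : ℝ → ℂ) (hb : Continuous b) (hb' : HasCompactSupport b) {n : ℕ} (hn : 1 ≤ n)
    (u : ℤ → Y) (C : ℝ) (hu : ∀ j, ‖u j‖ ≤ C) (k : ℤ) :
    HasSum (fun j => discreteCoeff b n (k - j) • u j)
      ((n : ℂ) • ∫ s in gridCell n k, ∫ x, b (s - x) • u ⌊(n : ℝ) * x⌋) := by
  have hbi : Integrable b volume := hb.integrable_of_hasCompactSupport hb'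
  have hf : StronglyMeasurable (fun x : ℝ => u ⌊(n : ℝ) * x⌋) :=
    (StronglyMeasurable.of_discrete (f := u)).comp_measurable
      (Int.measurable_floor.comp (measurable_const_mul _))
  have : IsFiniteMeasure (volume.restrict (gridCell n k)) := by
    refine ⟨?_⟩
    rw [Measure.restrict_apply_univ, volume_gridCell hn]
    simp; omega
  have hB : Integrable (fun z : ℝ × ℝ => b (z.1 - z.2))
      ((volume.restrict (gridCell n k)).prod volume) := by
    rw [integrable_prod_iff (by
      exact (hb.comp (continuous_fst.sub continuous_snd)).aestronglyMeasurable)]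
    refine ⟨Filter.Eventually.of_forall fun s => hbi.comp_sub_left s, ?_⟩
    have : (fun s : ℝ => ∫ x, ‖b (s - x)‖) = fun _ => ∫ x, ‖b x‖ := by
      ext s
      exact integral_sub_left_eq_self (fun x => ‖b x‖) volume s
    simp only [this]
    exact integrable_const _
  have hF : Integrable (fun z : ℝ × ℝ => b (z.1 - z.2) • u ⌊(n : ℝ) * z.2⌋)
      ((volume.restrict (gridCell n k)).prod volume) :=
    hB.smul_bdd C (hf.comp_measurable measurable_snd).aestronglyMeasurable
      (Filter.Eventually.of_forall fun z => hu _)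
  have hmeas : ∀ j, MeasurableSet ((Set.univ : Set ℝ) ×ˢ gridCell n j) := fun j =>
    MeasurableSet.univ.prod (measurableSet_gridCell n j)
  have hdisj : Pairwise (Function.onFun Disjoint
      (fun j => (Set.univ : Set ℝ) ×ˢ gridCell n j)) := fun i j hij =>
    Set.disjoint_prod.2 (Or.inr (disjoint_gridCell hn hij))
  have hU : (⋃ j, (Set.univ : Set ℝ) ×ˢ gridCell n j) = Set.univ := by
    rw [← Set.prod_iUnion, iUnion_gridCell hn, Set.univ_prod_univ]
  have hs := hasSum_integral_iUnion hmeas hdisj hF.integrableOn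
  rw [hU, Measure.restrict_univ, integral_prod _ hF] at hs
  refine (hs.const_smul (n : ℂ)).congr_fun ?_
  intro j
  rw [setIntegral_prod _ hF.integrableOn, Measure.restrict_univ, discreteCoeff_eq hn, mul_smul,
    ← integral_smul_const]
  congr 2
  ext s
  rw [← integral_smul_const]
  refine setIntegral_congr_fun (measurableSet_gridCell n j) fun x hx => ?_
  simp only [(mem_gridCell hn j x).1 hx]

/-- Let `1 ≤ p < ∞`, let `Y` be a complex Banach space, let `b : ℝ → ℂ`
be continuous with compact support and let `n ≥ 1`.  Then the operator norm of
`C_{a_n} ⊗ Id_Y` on `ℓ^p(ℤ; Y)` is at most the operator norm of `C_b ⊗ Id_Y` on the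
Bochner space `L^p(ℝ; Y)`. -/
theorem discrete_conv_norm_le_conv_norm (p : ℝ≥0∞) [Fact (1 ≤ p)] (hp : p ≠ ∞)
    (Y : Type*) [NormedAddCommGroup Y] [NormedSpace ℂ Y] [CompleteSpace Y]
    (b : ℝ → ℂ) (hb : Continuous b) (hb' : HasCompactSupport b)
    (n : ℕ) (hn : 1 ≤ n)
    (Cb : Lp Y p (volume : Measure ℝ) →L[ℂ] Lp Y p (volume : Measure ℝ))
    (hCb : ∀ f : Lp Y p (volume : Measure ℝ),
      ∀ᵐ s : ℝ, (Cb f : ℝ → Y) s = ∫ t : ℝ, b t • (f : ℝ → Y) (s - t))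
    (Ca : lp (fun _ : ℤ => Y) p →L[ℂ] lp (fun _ : ℤ => Y) p)
    (hCa : ∀ (u : lp (fun _ : ℤ => Y) p) (k : ℤ),
      (Ca u : ∀ _ : ℤ, Y) k = ∑' j : ℤ, discreteCoeff b n (k - j) • (u : ∀ _ : ℤ, Y) j) :
    ‖Ca‖ ≤ ‖Cb‖ := by
  have hp1 : 1 ≤ p := Fact.out
  have hp0 : p ≠ 0 := (zero_lt_one.trans_le hp1).ne'
  have hq : 1 ≤ p.toReal := by simpa using ENNReal.toReal_mono hp hp1
  have hq0 : 0 < p.toReal := by linarith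
  have hnt : (n : ℝ≥0∞) ≠ ∞ := ENNReal.natCast_ne_top n
  have hn0 : (n : ℝ≥0∞) ≠ 0 := by exact_mod_cast (by omega : n ≠ 0)
  refine ContinuousLinearMap.opNorm_le_bound _ (norm_nonneg _) fun u => ?_
  set f : ℝ → Y := fun x => (u : ∀ _ : ℤ, Y) ⌊(n : ℝ) * x⌋ with hfdef
  have hf : StronglyMeasurable f :=
    (StronglyMeasurable.of_discrete (f := (u : ∀ _ : ℤ, Y))).comp_measurable
      (Int.measurable_floor.comp (measurable_const_mul _))
  have hsum : ∑' j : ℤ, ‖(u : ∀ _ : ℤ, Y) j‖ₑ ^ p.toReal = ‖u‖ₑ ^ p.toReal := by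
    have h := lp.hasSum_norm hq0 u
    have h2 := ENNReal.ofReal_tsum_of_nonneg (fun j => by positivity) h.summable
    rw [h.tsum_eq] at h2
    simp only [← ENNReal.ofReal_rpow_of_nonneg (norm_nonneg _) hq0.le, ofReal_norm] at h2
    exact h2.symm
  have hint : ∫⁻ x, ‖f x‖ₑ ^ p.toReal = (n : ℝ≥0∞)⁻¹ * ‖u‖ₑ ^ p.toReal := by
    rw [← hsum]
    exact lintegral_step hn (fun j => ‖(u : ∀ _ : ℤ, Y) j‖ₑ ^ p.toReal)
  have hLp : MemLp f p volume := by
    refine ⟨hf.aestronglyMeasurable, ?_⟩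
    rw [eLpNorm_lt_top_iff_lintegral_rpow_enorm_lt_top hp0 hp, hint]
    exact ENNReal.mul_lt_top (ENNReal.inv_lt_top.2 (pos_iff_ne_zero.2 hn0))
      (ENNReal.rpow_lt_top_of_nonneg hq0.le enorm_ne_top)
  have hpow : ∀ g : Lp Y p (volume : Measure ℝ),
      ‖g‖ₑ ^ p.toReal = ∫⁻ x, ‖(g : ℝ → Y) x‖ₑ ^ p.toReal := by
    intro g
    rw [Lp.enorm_def, eLpNorm_eq_lintegral_rpow_enorm_toReal hp0 hp, ← ENNReal.rpow_mul,
      one_div_mul_cancel hq0.ne', ENNReal.rpow_one]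
  have hfn : ‖hLp.toLp f‖ₑ ^ p.toReal = (n : ℝ≥0∞)⁻¹ * ‖u‖ₑ ^ p.toReal := by
    rw [hpow, ← hint]
    refine lintegral_congr_ae ?_
    filter_upwards [hLp.coeFn_toLp] with x hx
    rw [hx]
  set g := Cb (hLp.toLp f) with hg
  have hgs : ∀ᵐ s : ℝ, (g : ℝ → Y) s = ∫ x, b (s - x) • f x := by
    filter_upwards [hCb (hLp.toLp f)] with s hs
    rw [hs, ← integral_sub_left_eq_self _ volume s]
    refine integral_congr_ae ?_
    filter_upwards [hLp.coeFn_toLp] with x hx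
    simp only [sub_sub_cancel, hx]
  have hCk : ∀ k, (Ca u : ∀ _ : ℤ, Y) k = (n : ℂ) • ∫ s in gridCell n k, (g : ℝ → Y) s := by
    intro k
    rw [hCa, (hasSum_gridCell b hb hb' hn _ ‖u‖ (lp.norm_apply_le_norm hp0 u) k).tsum_eq]
    congr 1
    refine integral_congr_ae (ae_restrict_of_ae ?_)
    filter_upwards [hgs] with s hs
    rw [hs]
  have hkey : ∑' k, ‖(Ca u : ∀ _ : ℤ, Y) k‖ₑ ^ p.toReal ≤ (‖Cb‖ₑ * ‖u‖ₑ) ^ p.toReal := by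
    calc ∑' k, ‖(Ca u : ∀ _ : ℤ, Y) k‖ₑ ^ p.toReal
        ≤ ∑' k, (n : ℝ≥0∞) * ∫⁻ s in gridCell n k, ‖(g : ℝ → Y) s‖ₑ ^ p.toReal := by
          refine ENNReal.tsum_le_tsum fun k => ?_
          rw [hCk]
          exact jensen_gridCell hp1 hp hn k _ (Lp.aestronglyMeasurable g)
      _ = n * ‖g‖ₑ ^ p.toReal := by
          rw [ENNReal.tsum_mul_left, ← lintegral_eq_tsum_gridCell hn, hpow]
      _ ≤ n * (‖Cb‖ₑ * ‖hLp.toLp f‖ₑ) ^ p.toReal := by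
          gcongr
          exact Cb.le_opENorm _
      _ = (‖Cb‖ₑ * ‖u‖ₑ) ^ p.toReal := by
          rw [ENNReal.mul_rpow_of_nonneg _ _ hq0.le, hfn, ENNReal.mul_rpow_of_nonneg _ _ hq0.le,
            mul_left_comm, ← mul_assoc (n : ℝ≥0∞), ENNReal.mul_inv_cancel hn0 hnt, one_mul]
  refine lp.norm_le_of_forall_sum_le hq0 (by positivity) fun s => ?_
  have h3 := (ENNReal.sum_le_tsum s).trans hkey
  rw [← ENNReal.ofReal_le_ofReal_iff (by positivity),
    ENNReal.ofReal_sum_of_nonneg (fun i _ => by positivity)]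
  simp only [← ENNReal.ofReal_rpow_of_nonneg (norm_nonneg _) hq0.le, ofReal_norm]
  rw [← ENNReal.ofReal_rpow_of_nonneg (by positivity) hq0.le,
    ENNReal.ofReal_mul (norm_nonneg _), ofReal_norm, ofReal_norm]
  exact h3
end

section
/- Let X be a complex Banach space, let b : ℝ → ℂ be continuous with compact support, let n ≥ 1 be an integer, and let f : ℝ → X be a continuous function which is affine on each interval [k/n, (k+1)/n], k ∈ ℤ. Then ∫_ℝ b(t) f(t) dt = Σ_{k∈ℤ} a_{n,k} f(k/n) (the sum having only finitely many nonzero terms). -/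
open scoped ENNReal
open MeasureTheory

lemma coeff_aux (c : ℝ → ℂ) (hc : Continuous c) (k : ℤ) :
    (∫ t in (0:ℝ)..1, ∫ s in (0:ℝ)..1, c (t - s + (k : ℝ)))
      = (∫ t in (0:ℝ)..1, c (t + k) * ((1 - t : ℝ) : ℂ))
        + ∫ t in (0:ℝ)..1, c (t + ((k - 1 : ℤ) : ℝ)) * ((t : ℝ) : ℂ) := by
  have hi : ∀ a b : ℝ, IntervalIntegrable (fun u => c (u + k)) volume a b := fun a b =>
    Continuous.intervalIntegrable (by fun_prop) _ _
  set D : ℝ → ℂ := fun t => ∫ u in (0:ℝ)..t, c (u + k) with hD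
  have hDd : ∀ t, HasDerivAt D (c (t + k)) t := fun t =>
    intervalIntegral.integral_hasDerivAt_right (hi _ _)
      (Continuous.stronglyMeasurableAtFilter (by fun_prop) _ _) (by fun_prop)
  have hDc : Continuous D := continuous_iff_continuousAt.2 fun t => (hDd t).continuousAt
  have hin : ∀ t : ℝ, (∫ s in (0:ℝ)..1, c (t - s + (k : ℝ))) = D t - D (t - 1) := by
    intro t
    rw [intervalIntegral.integral_comp_sub_left (fun u => c (u + k)) t, hD]
    simp only [sub_zero]
    rw [intervalIntegral.integral_interval_sub_left (hi _ _) (hi _ _)]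
  simp_rw [hin]
  rw [intervalIntegral.integral_sub (hDc.intervalIntegrable _ _)
    (Continuous.intervalIntegrable (by fun_prop) _ _), sub_eq_add_neg]
  have h1 : (∫ t in (0:ℝ)..1, D t) = ∫ t in (0:ℝ)..1, c (t + k) * ((1 - t : ℝ) : ℂ) := by
    have := intervalIntegral.integral_mul_deriv_eq_deriv_mul (a := 0) (b := 1)
      (u := D) (u' := fun t => c (t + k)) (v := fun t : ℝ => ((t - 1 : ℝ) : ℂ)) (v' := fun _ => 1)
      (fun t _ => hDd t) (fun t _ => ((hasDerivAt_id t).sub_const 1).ofReal_comp)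
      (hi _ _) (by simp)
    have h0 : D 0 = 0 := by simp [hD]
    simp only [mul_one, h0] at this
    rw [this]
    simp only [sub_self, Complex.ofReal_zero, mul_zero, zero_mul, zero_sub]
    rw [← intervalIntegral.integral_neg]
    refine intervalIntegral.integral_congr fun t _ => ?_
    push_cast; ring
  have h2 : -(∫ t in (0:ℝ)..1, D (t - 1))
      = ∫ t in (0:ℝ)..1, c (t + ((k - 1 : ℤ) : ℝ)) * ((t : ℝ) : ℂ) := by
    have hd : ∀ t, HasDerivAt (fun t => D (t - 1)) (c (t + ((k - 1 : ℤ) : ℝ))) t := by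
      intro t
      have := (hDd (t - 1)).comp_sub_const t 1
      have e : t + ((k - 1 : ℤ) : ℝ) = t - 1 + k := by push_cast; ring
      rw [e]; exact this
    have := intervalIntegral.integral_mul_deriv_eq_deriv_mul (a := 0) (b := 1)
      (u := fun t => D (t - 1)) (u' := fun t => c (t + ((k - 1 : ℤ) : ℝ)))
      (v := fun t : ℝ => ((t : ℝ) : ℂ)) (v' := fun _ => 1)
      (fun t _ => hd t) (fun t _ => (hasDerivAt_id t).ofReal_comp)
      (Continuous.intervalIntegrable (by fun_prop) _ _) (by simp)
    have h0 : D 0 = 0 := by simp [hD]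
    simp only [mul_one] at this
    rw [this]
    simp [h0]
  rw [h1, h2]

lemma summable_aux {X : Type*} [NormedAddCommGroup X] [NormedSpace ℂ X]
    (c : ℝ → ℂ) (hc : HasCompactSupport c) (w : ℝ → ℂ) (x : ℤ → X) :
    Summable fun k : ℤ => (∫ t in (0:ℝ)..1, c (t + k) * w t) • x k := by
  obtain ⟨R, hR⟩ := hc.isCompact.isBounded.subset_closedBall 0
  have hz : ∀ y : ℝ, R < |y| → c y = 0 := by
    intro y hy
    by_contra h
    have := hR (subset_tsupport c h)
    simp at this
    linarith
  apply summable_of_hasFiniteSupport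
  refine (Set.finite_Icc (⌊-R⌋ - 2) (⌈R⌉ + 2)).subset ?_
  intro k hk
  by_contra hkn
  apply hk
  have : (∫ t in (0:ℝ)..1, c (t + k) * w t) = ∫ t in (0:ℝ)..1, (0 : ℂ) := by
    apply intervalIntegral.integral_congr
    intro t ht
    rw [Set.uIcc_of_le zero_le_one] at ht
    have : c (t + k) = 0 := by
      apply hz
      rw [Set.mem_Icc, not_and_or, not_le, not_le] at hkn
      rcases hkn with h | h
      · have h' : (k : ℝ) < ⌊-R⌋ - 2 := by exact_mod_cast h
        have := Int.floor_le (-R)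
        rw [lt_abs]; right; linarith [ht.2]
      · have h' : (⌈R⌉ : ℝ) + 2 < k := by exact_mod_cast h
        have := Int.le_ceil R
        rw [lt_abs]; left; linarith [ht.1]
    simp [this]
  simp [this]

/-- Let `X` be a complex Banach space, `b : ℝ → ℂ` continuous with
compact support, `n ≥ 1`, and let `f : ℝ → X` be continuous and affine on each interval
`[k/n, (k+1)/n]`, `k ∈ ℤ`.  Then `∫_ℝ b(t) f(t) dt = Σ_{k∈ℤ} a_{n,k} f(k/n)`. -/
theorem integral_eq_sum_discreteCoeff
    (X : Type*) [NormedAddCommGroup X] [NormedSpace ℂ X] [CompleteSpace X]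
    (b : ℝ → ℂ) (hb : Continuous b) (hb' : HasCompactSupport b)
    (n : ℕ) (hn : 1 ≤ n) (f : ℝ → X) (hf : Continuous f)
    (haff : ∀ k : ℤ, ∀ l ∈ Set.Icc (0:ℝ) 1,
      f ((1 - l) * ((k : ℝ) / n) + l * (((k : ℝ) + 1) / n))
        = ((1 - l : ℝ) : ℂ) • f ((k : ℝ) / n) + ((l : ℝ) : ℂ) • f (((k : ℝ) + 1) / n)) :
    ∫ t : ℝ, b t • f t = ∑' k : ℤ, discreteCoeff b n k • f ((k : ℝ) / n) := by
  have hn0 : (0 : ℝ) < n := by exact_mod_cast hn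
  set c : ℝ → ℂ := fun x => (1 / (n : ℂ)) * b (x / n) with hc
  have hcc : Continuous c := by fun_prop
  have hcs : HasCompactSupport c := by
    have : HasCompactSupport fun x : ℝ => b (x / n) := by
      have := hb'.comp_homeomorph (Homeomorph.mulRight₀ ((n : ℝ)⁻¹) (by positivity))
      simpa [Function.comp_def, div_eq_mul_inv] using this
    exact this.mul_left
  have hA : ∀ k, discreteCoeff b n k
      = (∫ t in (0:ℝ)..1, c (t + k) * ((1 - t : ℝ) : ℂ))
        + ∫ t in (0:ℝ)..1, c (t + ((k - 1 : ℤ) : ℝ)) * ((t : ℝ) : ℂ) := fun k =>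
    coeff_aux c hcc k
  have hint : ∫ t : ℝ, b t • f t = ∫ u : ℝ, c u • f (u / n) := by
    have := Measure.integral_comp_div (fun t => b t • f t) (n : ℝ)
    have h2 : ∀ u : ℝ, c u • f (u / n) = (1 / (n : ℂ)) • (b (u / n) • f (u / n)) := by
      intro u; simp only [hc, mul_smul]
    simp_rw [h2]
    rw [integral_smul, this, abs_of_pos hn0, ← Complex.coe_smul, smul_smul]
    have : (n : ℂ) ≠ 0 := by exact_mod_cast hn0.ne'
    simp [this]
  have hI : Integrable fun u : ℝ => c u • f (u / n) :=
    Continuous.integrable_of_hasCompactSupport (hcc.smul (by fun_prop)) hcs.smul_right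
  have hS := hI.hasSum_intervalIntegral_comp_add_int
  have hterm : ∀ k : ℤ, (∫ t in (0:ℝ)..1, c (t + k) • f ((t + k) / n))
      = (∫ t in (0:ℝ)..1, c (t + k) * ((1 - t : ℝ) : ℂ)) • f ((k : ℝ) / n)
        + (∫ t in (0:ℝ)..1, c (t + k) * ((t : ℝ) : ℂ)) • f (((k : ℝ) + 1) / n) := by
    intro k
    rw [← intervalIntegral.integral_smul_const, ← intervalIntegral.integral_smul_const,
      ← intervalIntegral.integral_add (Continuous.intervalIntegrable (by fun_prop) _ _)
        (Continuous.intervalIntegrable (by fun_prop) _ _)]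
    apply intervalIntegral.integral_congr
    intro t ht
    rw [Set.uIcc_of_le zero_le_one] at ht
    have h := haff k t ht
    have e : (1 - t) * ((k : ℝ) / n) + t * (((k : ℝ) + 1) / n) = (t + k) / n := by ring
    rw [e] at h
    simp only [h, smul_add, mul_smul]
  simp_rw [hterm] at hS
  have s1 := summable_aux c hcs (fun t => ((1 - t : ℝ) : ℂ)) (fun k => f ((k : ℝ) / n))
  have s2 := summable_aux c hcs (fun t => ((t : ℝ) : ℂ)) (fun k => f (((k : ℝ) + 1) / n))
  rw [hint, ← hS.tsum_eq, s1.tsum_add s2]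
  simp_rw [hA, add_smul]
  have he := (Equiv.subRight (1 : ℤ)).hasSum_iff.2 s2.hasSum
  have he' : HasSum (fun k : ℤ =>
      (∫ t in (0:ℝ)..1, c (t + ((k - 1 : ℤ) : ℝ)) * ((t : ℝ) : ℂ)) • f ((k : ℝ) / n))
      (∑' k : ℤ, (∫ t in (0:ℝ)..1, c (t + k) * ((t : ℝ) : ℂ)) • f (((k : ℝ) + 1) / n)) := by
    convert he using 2 with k
    simp
  rw [(s1.hasSum.add he').tsum_eq]
end

section
/- Let X be a complex Banach space, let (T_t)_{t≥0} be a C₀-semigroup of contractions on X, and let b : ℝ → ℂ be continuous with compact support contained in [0,∞). Then for every x ∈ X, Σ_{k=0}^∞ a_{n,k} T_{k/n}(x) converges, as n → ∞, to ∫_0^∞ b(t) T_t(x) dt in X. -/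
open scoped ENNReal
open MeasureTheory

lemma avg_close (φ : ℝ → ℂ) (hφ : Continuous φ) (z : ℂ) (ε : ℝ)
    (h : ∀ t ∈ Set.Icc (0:ℝ) 1, ‖φ t - z‖ ≤ ε) : ‖(∫ t in (0:ℝ)..1, φ t) - z‖ ≤ ε := by
  have h1 : (∫ t in (0:ℝ)..1, φ t) - z = ∫ t in (0:ℝ)..1, (φ t - z) := by
    rw [intervalIntegral.integral_sub (hφ.intervalIntegrable _ _) (by simp)]
    simp
  rw [h1]
  have := intervalIntegral.norm_integral_le_of_norm_le_const (a := (0:ℝ)) (b := 1)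
    (f := fun t => φ t - z) (C := ε) (by
      intro t ht
      rw [Set.uIoc_of_le zero_le_one] at ht
      exact h t ⟨ht.1.le, ht.2⟩)
  simpa using this

lemma discreteCoeff_close (b : ℝ → ℂ) (hb : Continuous b) (n : ℕ) (hn : n ≠ 0) (k : ℤ) (z : ℂ)
    (ε : ℝ) (h : ∀ t ∈ Set.Icc (0:ℝ) 1, ∀ s ∈ Set.Icc (0:ℝ) 1,
      ‖b ((t - s + (k : ℝ)) / n) - z‖ ≤ ε) :
    ‖(n : ℂ) * discreteCoeff b n k - z‖ ≤ ε := by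
  have hn' : (n : ℂ) ≠ 0 := by exact_mod_cast hn
  have h1 : (n : ℂ) * discreteCoeff b n k =
      ∫ t in (0:ℝ)..1, ∫ s in (0:ℝ)..1, b ((t - s + (k : ℝ)) / n) := by
    unfold discreteCoeff
    simp only [intervalIntegral.integral_const_mul]
    field_simp
  rw [h1]
  apply avg_close
  · apply intervalIntegral.continuous_parametric_intervalIntegral_of_continuous'
    fun_prop
  · intro t ht
    exact avg_close _ (by fun_prop) _ _ (h t ht)

/-- Let `X` be a complex Banach space, `(T_t)_{t≥0}` a `C₀`-semigroup of
contractions on `X`, and `b : ℝ → ℂ` continuous with compact support contained in `[0,∞)`.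
Then for every `x ∈ X`, `Σ_{k=0}^∞ a_{n,k} T_{k/n}(x)` converges, as `n → ∞`, to
`∫_0^∞ b(t) T_t(x) dt`. -/
theorem tendsto_sum_discreteCoeff_semigroup
    (X : Type*) [NormedAddCommGroup X] [NormedSpace ℂ X] [CompleteSpace X]
    (T : ℝ → (X →L[ℂ] X))
    (hT0 : T 0 = 1)
    (hTadd : ∀ s t : ℝ, 0 ≤ s → 0 ≤ t → T (s + t) = (T s).comp (T t))
    (hTcontr : ∀ t : ℝ, 0 ≤ t → ‖T t‖ ≤ 1)
    (hTcont : ∀ x : X, ContinuousOn (fun t : ℝ => T t x) (Set.Ici 0))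
    (b : ℝ → ℂ) (hb : Continuous b) (hb' : HasCompactSupport b)
    (hbsupp : Function.support b ⊆ Set.Ici 0) :
    ∀ x : X, Filter.Tendsto
      (fun n : ℕ => ∑' k : ℕ, discreteCoeff b n (k : ℤ) • T ((k : ℝ) / n) x)
      Filter.atTop (nhds (∫ t in Set.Ici (0:ℝ), b t • T t x)) := by
  intro x
  set g : ℝ → X := fun t => T (max t 0) x with hg
  have hgc : Continuous g :=
    (hTcont x).comp_continuous (by fun_prop) (fun t => le_max_right t 0)
  have hgT : ∀ t : ℝ, 0 ≤ t → T t x = g t := fun t ht => by simp [hg, max_eq_left ht]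
  have hgb : ∀ t, ‖g t‖ ≤ ‖x‖ := fun t => by
    simpa using (T (max t 0)).le_of_opNorm_le (hTcontr _ (le_max_right t 0)) x
  obtain ⟨M, hM⟩ := hb.bounded_above_of_compact_support hb'
  have hM0 : 0 ≤ M := (norm_nonneg _).trans (hM 0)
  -- support
  obtain ⟨N, hN0, hN⟩ : ∃ N : ℕ, 0 < N ∧ ∀ v : ℝ, (N : ℝ) - 1 ≤ v → b v = 0 := by
    obtain ⟨R, hR⟩ := hb'.isCompact.isBounded.subset_closedBall 0
    obtain ⟨N, hN⟩ := exists_nat_gt (R + 1)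
    refine ⟨N + 1, by omega, fun v hv => ?_⟩
    by_contra hne
    have := hR (subset_tsupport b hne)
    rw [Metric.mem_closedBall, dist_zero_right, Real.norm_eq_abs] at this
    have := (le_abs_self v).trans this
    push_cast at hv
    linarith
  have hhc : Continuous fun u => b u • g u := hb.smul hgc
  have hint : (∫ t in Set.Ici (0:ℝ), b t • T t x) = ∫ t in (0:ℝ)..N, b t • g t := by
    rw [intervalIntegral.integral_of_le (Nat.cast_nonneg N), ← integral_Icc_eq_integral_Ioc]
    rw [setIntegral_congr_fun (g := fun t => b t • g t) measurableSet_Ici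
      (fun t ht => by simp only [hgT t ht])]
    apply setIntegral_eq_of_subset_of_forall_sdiff_eq_zero measurableSet_Ici
      (fun t ht => ht.1)
    rintro t ⟨ht, ht'⟩
    have : (N:ℝ) < t := by
      by_contra hc
      exact ht' ⟨ht, not_lt.1 hc⟩
    simp [hN t (by linarith)]
  rw [hint, Metric.tendsto_atTop]
  intro ε hε
  set η : ℝ := ε / (2 * N * (‖x‖ + M + 1)) with hη
  have hNr : (0:ℝ) < N := by exact_mod_cast hN0
  have hx0 := norm_nonneg x
  have hη0 : 0 < η := by positivity
  have hbu : UniformContinuous b := hb'.uniformContinuous_of_continuous hb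
  have hgu : UniformContinuousOn g (Set.Icc 0 N) :=
    isCompact_Icc.uniformContinuousOn_of_continuous hgc.continuousOn
  obtain ⟨δ₁, hδ₁, H1⟩ := Metric.uniformContinuous_iff.1 hbu η hη0
  obtain ⟨δ₂, hδ₂, H2⟩ := Metric.uniformContinuousOn_iff.1 hgu η hη0
  obtain ⟨n₀, hn₀⟩ := exists_nat_gt (2 / min δ₁ δ₂)
  refine ⟨n₀ + 1, fun n hn => ?_⟩
  have hn0 : n ≠ 0 := by omega
  have hnr : (0:ℝ) < n := by exact_mod_cast Nat.pos_of_ne_zero hn0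
  have hnc : (n:ℂ) ≠ 0 := by exact_mod_cast hn0
  have hn1 : (1:ℝ) ≤ n := by exact_mod_cast Nat.pos_of_ne_zero hn0
  have hsmall : 2 / (n:ℝ) < min δ₁ δ₂ := by
    have hmin : 0 < min δ₁ δ₂ := lt_min hδ₁ hδ₂
    have h3 : (n₀:ℝ) < n := by exact_mod_cast (by omega : n₀ < n)
    rw [div_lt_iff₀ hmin] at hn₀
    rw [div_lt_iff₀ hnr]
    nlinarith
  have hs1 : 2 / (n:ℝ) < δ₁ := hsmall.trans_le (min_le_left _ _)
  have hs2 : 2 / (n:ℝ) < δ₂ := hsmall.trans_le (min_le_right _ _)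
  have hzero : ∀ k : ℕ, n * N ≤ k → discreteCoeff b n (k : ℤ) = 0 := by
    intro k hk
    have := discreteCoeff_close b hb n hn0 k 0 0 (by
      intro t ht s hs
      rw [hN]
      · simp
      · have hk' : (n:ℝ) * N ≤ k := by exact_mod_cast hk
        rw [le_div_iff₀ hnr]
        push_cast
        nlinarith [ht.1, hs.2])
    rw [sub_zero] at this
    exact (mul_eq_zero.1 (norm_le_zero_iff.1 this)).resolve_left hnc
  rw [tsum_eq_sum (s := Finset.range (n * N)) (fun k hk => by
    rw [hzero k (by simpa using hk), zero_smul])]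
  have hsplit : ∫ t in (0:ℝ)..N, b t • g t =
      ∑ k ∈ Finset.range (n * N), ∫ t in ((k:ℝ)/n)..((k+1:ℕ):ℝ)/n, b t • g t := by
    rw [intervalIntegral.sum_integral_adjacent_intervals (a := fun k : ℕ => (k:ℝ)/n)
      (fun k _ => hhc.intervalIntegrable _ _)]
    have : ((n * N : ℕ) : ℝ) / n = N := by push_cast; field_simp
    rw [this]
    simp
  rw [hsplit, dist_eq_norm, ← Finset.sum_sub_distrib]
  have hterm : ∀ k ∈ Finset.range (n * N),
      ‖discreteCoeff b n (k:ℤ) • T ((k:ℝ)/n) x -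
        ∫ t in ((k:ℝ)/n)..((k+1:ℕ):ℝ)/n, b t • g t‖ ≤ (η * (‖x‖ + M)) * (1 / n) := by
    intro k hk
    have hkN : k + 1 ≤ n * N := by simpa using hk
    have hkN' : ((k:ℝ) + 1) ≤ n * N := by exact_mod_cast hkN
    have hlen : ((k+1:ℕ):ℝ)/n - (k:ℝ)/n = 1 / n := by push_cast; ring
    have hle : (k:ℝ)/n ≤ ((k+1:ℕ):ℝ)/n := by
      have : (0:ℝ) ≤ 1 / n := by positivity
      linarith
    have hk0 : (0:ℝ) ≤ (k:ℝ)/n := by positivity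
    have hkT : ((k+1:ℕ):ℝ)/n ≤ N := by
      rw [div_le_iff₀ hnr]; push_cast; linarith
    have e1 : discreteCoeff b n (k:ℤ) • T ((k:ℝ)/n) x =
        ∫ t in ((k:ℝ)/n)..((k+1:ℕ):ℝ)/n, ((n:ℂ) * discreteCoeff b n (k:ℤ)) • g ((k:ℝ)/n) := by
      rw [intervalIntegral.integral_const, hlen, hgT _ hk0, ← Complex.coe_smul, smul_smul]
      congr 1
      push_cast
      field_simp
    rw [e1, ← intervalIntegral.integral_sub (by simp) (hhc.intervalIntegrable _ _)]
    have := intervalIntegral.norm_integral_le_of_norm_le_const (a := (k:ℝ)/n)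
      (b := ((k+1:ℕ):ℝ)/n)
      (f := fun t => ((n:ℂ) * discreteCoeff b n (k:ℤ)) • g ((k:ℝ)/n) - b t • g t)
      (C := η * (‖x‖ + M)) ?_
    · rwa [hlen, abs_of_nonneg (by positivity)] at this
    intro u hu
    rw [Set.uIoc_of_le hle] at hu
    have hu1 : (k:ℝ) < u * n := (div_lt_iff₀ hnr).1 hu.1
    have hu2 : u * n ≤ k + 1 := by
      have := (le_div_iff₀ hnr).1 hu.2
      push_cast at this; exact this
    have hc : ‖(n:ℂ) * discreteCoeff b n (k:ℤ) - b u‖ ≤ η := by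
      apply discreteCoeff_close b hb n hn0
      intro t ht s hs
      rw [← dist_eq_norm]
      refine (H1 (lt_of_le_of_lt ?_ hs1)).le
      have e : (t - s + ((k:ℤ):ℝ)) / n - u = (t - s + k - u * n) / n := by
        push_cast; field_simp
      rw [Real.dist_eq, e, abs_div, abs_of_pos hnr]
      gcongr
      rw [abs_le]
      constructor <;> linarith [ht.1, ht.2, hs.1, hs.2]
    have hgk : ‖g ((k:ℝ)/n) - g u‖ ≤ η := by
      rw [← dist_eq_norm]
      refine (H2 _ ⟨hk0, hle.trans hkT⟩ _ ⟨hk0.trans hu.1.le, hu.2.trans hkT⟩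
        (lt_of_le_of_lt ?_ hs2)).le
      have e : (k:ℝ) / n - u = (k - u * n) / n := by field_simp
      rw [Real.dist_eq, e, abs_div, abs_of_pos hnr]
      gcongr
      rw [abs_le]
      constructor <;> linarith
    have e2 : ((n:ℂ) * discreteCoeff b n (k:ℤ)) • g ((k:ℝ)/n) - b u • g u =
        ((n:ℂ) * discreteCoeff b n (k:ℤ) - b u) • g ((k:ℝ)/n)
          + b u • (g ((k:ℝ)/n) - g u) := by
      rw [sub_smul, smul_sub]; abel
    change ‖((n:ℂ) * discreteCoeff b n (k:ℤ)) • g ((k:ℝ)/n) - b u • g u‖ ≤ _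
    rw [e2]
    refine (norm_add_le _ _).trans ?_
    rw [norm_smul, norm_smul]
    have i1 := mul_le_mul hc (hgb ((k:ℝ)/n)) (norm_nonneg _) hη0.le
    have i2 := mul_le_mul (hM u) hgk (norm_nonneg _) hM0
    linarith
  refine lt_of_le_of_lt (norm_sum_le_of_le _ hterm) ?_
  rw [Finset.sum_const, Finset.card_range, nsmul_eq_mul]
  have e3 : ((n * N : ℕ):ℝ) * (η * (‖x‖ + M) * (1 / n)) = N * η * (‖x‖ + M) := by
    push_cast; field_simp
  have e4 : N * η * (‖x‖ + M + 1) = ε / 2 := by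
    rw [hη]; field_simp
  rw [e3]
  have : 0 < N * η := by positivity
  nlinarith
end

section
/- Let 1 < p < ∞, let X and Y be complex Banach spaces, and let (T_t)_{t≥0} be a C₀-semigroup of contractions on X such that for every t ≥ 0 and every complex polynomial P one has ‖P(T_t)‖_{X→X} ≤ ‖P(S)⊗Id_Y‖_{ℓ^p(ℤ;Y)→ℓ^p(ℤ;Y)}. Then for every b ∈ L¹(ℝ) with support contained in [0,∞), ‖∫_0^∞ b(t) T_t dt‖_{X→X} ≤ ‖C_b⊗Id_Y‖_{L^p(ℝ;Y)→L^p(ℝ;Y)}. -/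
open scoped ENNReal
open MeasureTheory

theorem sm_lemma_sum {Ω : Type*} [MeasurableSpace Ω] (μ : Measure Ω) (g : Ω → ℂ)
    (hg : Integrable g μ) (N : Ω → ℕ) (hN : Measurable N)
    {E : Type*} [NormedAddCommGroup E] [NormedSpace ℂ E] [CompleteSpace E]
    (F : ℕ → E) (C : ℝ) (hF : ∀ k, ‖F k‖ ≤ C) :
    Integrable (fun ω => g ω • F (N ω)) μ ∧
    HasSum (fun k => (∫ ω in N ⁻¹' {k}, g ω ∂μ) • F k) (∫ ω, g ω • F (N ω) ∂μ) := by
  have hint : Integrable (fun ω => g ω • F (N ω)) μ := by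
    refine Integrable.mono' (hg.norm.mul_const C) ?_ ?_
    · exact hg.aestronglyMeasurable.smul
        ((StronglyMeasurable.of_discrete (f := F)).comp_measurable hN).aestronglyMeasurable
    · refine Filter.Eventually.of_forall fun ω => ?_
      rw [norm_smul]
      exact mul_le_mul_of_nonneg_left (hF _) (norm_nonneg _)
  refine ⟨hint, ?_⟩
  have hm : ∀ k : ℕ, MeasurableSet (N ⁻¹' {k}) := fun k => hN (measurableSet_singleton k)
  have hU : (⋃ k : ℕ, N ⁻¹' {k}) = Set.univ := by
    ext ω; simp
  have h := hasSum_integral_iUnion (μ := μ) (f := fun ω => g ω • F (N ω)) hm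
    (by
      intro i j hij
      rw [Function.onFun, Set.disjoint_left]
      intro ω h1 h2
      simp only [Set.mem_preimage, Set.mem_singleton_iff] at h1 h2
      exact hij (h1.symm.trans h2)) (by rw [hU]; exact hint.integrableOn)
  rw [hU, Measure.restrict_univ] at h
  convert h using 2 with k
  rw [← integral_smul_const]
  refine setIntegral_congr_fun (hm k) fun ω hω => ?_
  simp only [Set.mem_preimage, Set.mem_singleton_iff] at hω
  simp [hω]

theorem sm_summable {Ω : Type*} [MeasurableSpace Ω] (μ : Measure Ω) (g : Ω → ℂ)
    (hg : Integrable g μ) (N : Ω → ℕ) (hN : Measurable N) :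
    Summable (fun k => ‖∫ ω in N ⁻¹' {k}, g ω ∂μ‖) := by
  have h := (sm_lemma_sum μ (fun ω => ((‖g ω‖ : ℝ) : ℂ)) hg.norm.ofReal N hN
    (fun _ => (1:ℂ)) 1 (by simp)).2.summable.norm
  refine h.of_nonneg_of_le (fun _ => norm_nonneg _) fun k => ?_
  rw [smul_eq_mul, mul_one, integral_complex_ofReal, Complex.norm_real]
  exact (norm_integral_le_integral_norm _).trans (le_abs_self _)

theorem sm_cell (h : ℝ) (hh : 0 < h) (G : ℝ → ℝ≥0∞) (hG : Measurable G) :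
    ∫⁻ s, G s = ENNReal.ofReal h * ∑' j : ℤ, ∫⁻ θ in Set.Ico (0:ℝ) 1, G (((j:ℝ) + θ) * h) := by
  have h1 : ∫⁻ s, G s = ENNReal.ofReal h * ∫⁻ u, G (u * h) := by
    have := Real.map_volume_mul_right hh.ne'
    have h2 : ∫⁻ u, G (u * h) = ∫⁻ s, G s ∂(Measure.map (· * h) volume) := by
      rw [lintegral_map hG (by fun_prop)]
    rw [h2, this, lintegral_smul_measure, smul_eq_mul, ← mul_assoc, ← ENNReal.ofReal_mul hh.le,
      abs_of_pos (inv_pos.2 hh), mul_inv_cancel₀ hh.ne', ENNReal.ofReal_one, one_mul]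
  rw [h1]
  congr 1
  have h3 := lintegral_iUnion (μ := (volume : Measure ℝ)) (s := fun n : ℤ => Set.Ico (n:ℝ) (n+1))
    (fun _ => measurableSet_Ico) (Set.pairwise_disjoint_Ico_intCast ℝ) (fun u => G (u * h))
  rw [iUnion_Ico_intCast, Measure.restrict_univ] at h3
  rw [h3]
  congr 1
  ext j
  rw [← lintegral_indicator measurableSet_Ico, ← lintegral_indicator measurableSet_Ico,
    ← lintegral_add_left_eq_self _ (j:ℝ)]
  congr 1
  ext θ
  simp only [Set.indicator, Set.mem_Ico]
  simp

theorem sm_qmp (h : ℝ) (hh : 0 < h) (j : ℝ) :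
    Measure.QuasiMeasurePreserving (fun θ : ℝ => (j + θ) * h) (volume.restrict (Set.Ico (0:ℝ) 1)) volume := by
  have h1 : Measure.QuasiMeasurePreserving (fun s : ℝ => s * h) volume volume := by
    refine ⟨by fun_prop, ?_⟩
    rw [Real.map_volume_mul_right hh.ne']
    exact Measure.smul_absolutelyContinuous
  have h2 : Measure.QuasiMeasurePreserving (fun s : ℝ => j + s) volume volume :=
    (measurePreserving_add_left volume j).quasiMeasurePreserving
  exact (h1.comp h2).mono_left Measure.absolutelyContinuous_restrict

theorem sm_lp_enorm {Y : Type*} [NormedAddCommGroup Y] (p : ℝ≥0∞) [Fact (1 ≤ p)] (hp : 0 < p.toReal)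
    (x : lp (fun _ : ℤ => Y) p) :
    ‖x‖ₑ ^ p.toReal = ∑' j : ℤ, ‖(x : ∀ _ : ℤ, Y) j‖ₑ ^ p.toReal := by
  have h := lp.norm_rpow_eq_tsum hp x
  have h' := (lp.memℓp x).summable hp
  rw [← ofReal_norm, ENNReal.ofReal_rpow_of_nonneg (norm_nonneg _) hp.le, h,
    ENNReal.ofReal_tsum_of_nonneg (fun _ => by positivity) h']
  simp_rw [← ofReal_norm, ENNReal.ofReal_rpow_of_nonneg (norm_nonneg _) hp.le]

theorem sm_Lp_enorm {Y : Type*} [NormedAddCommGroup Y] (p : ℝ≥0∞) (hp : 0 < p.toReal)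
    {Ω : Type*} [MeasurableSpace Ω] (μ : Measure Ω) (f : Ω → Y) :
    eLpNorm f p μ ^ p.toReal = ∫⁻ s, ‖f s‖ₑ ^ p.toReal ∂μ := by
  obtain ⟨h0, h1⟩ := ENNReal.toReal_pos_iff.1 hp
  rw [eLpNorm_eq_lintegral_rpow_enorm_toReal h0.ne' h1.ne, ← ENNReal.rpow_mul, one_div, inv_mul_cancel₀ hp.ne',
    ENNReal.rpow_one]

theorem sm_floor (h θ t : ℝ) (hh : 0 < h) (ht : 0 ≤ t) (h1 : θ < 1) (j : ℤ) :
    ⌊(((j:ℝ) + θ) * h - t) / h⌋ = j - (⌈t / h - θ⌉₊ : ℤ) := by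
  have e : (((j:ℝ) + θ) * h - t) / h = (j:ℝ) + -(t / h - θ) := by field_simp; ring
  have h2 : 0 ≤ ⌈t / h - θ⌉ := by
    have : -1 < ⌈t / h - θ⌉ := by
      rw [Int.lt_ceil]
      have : 0 ≤ t / h := by positivity
      push_cast; linarith
    omega
  rw [e, Int.floor_intCast_add, Int.floor_neg, Int.natCast_ceil_eq_ceil_of_neg_one_lt]
  · ring
  · have : 0 ≤ t / h := by positivity
    linarith

theorem sm_Y (p : ℝ≥0∞) [Fact (1 ≤ p)] (hp : 0 < p.toReal)
    {Y : Type*} [NormedAddCommGroup Y] [NormedSpace ℂ Y] [CompleteSpace Y]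
    (b : ℝ → ℂ) (hb : Integrable b (volume : Measure ℝ))
    (hbsupp : Function.support b ⊆ Set.Ici 0)
    (Cb : Lp Y p (volume : Measure ℝ) →L[ℂ] Lp Y p (volume : Measure ℝ))
    (hCb : ∀ f : Lp Y p (volume : Measure ℝ),
      ∀ᵐ s : ℝ, (Cb f : ℝ → Y) s = ∫ t : ℝ, b t • (f : ℝ → Y) (s - t))
    (h : ℝ) (hh : 0 < h) (x z : lp (fun _ : ℤ => Y) p)
    (hz : ∀ j : ℤ, (z : ∀ _ : ℤ, Y) j =
      ∫ ω : ℝ × ℝ, b ω.2 • (x : ∀ _ : ℤ, Y) (j - (⌈ω.2 / h - ω.1⌉₊ : ℤ))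
        ∂((volume.restrict (Set.Ico (0:ℝ) 1)).prod volume)) :
    ‖z‖ ≤ ‖Cb‖ * ‖x‖ := by
  obtain ⟨hp0, hp1⟩ := ENNReal.toReal_pos_iff.1 hp
  have : IsProbabilityMeasure (volume.restrict (Set.Ico (0:ℝ) 1)) := ⟨by simp⟩
  set f0 : ℝ → Y := fun s => (x : ∀ _ : ℤ, Y) ⌊s / h⌋ with hf0
  have hf0m : StronglyMeasurable f0 :=
    (StronglyMeasurable.of_discrete (f := (x : ∀ _ : ℤ, Y))).comp_measurable
      (Int.measurable_floor.comp (measurable_id.div_const h))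
  have hf0n : eLpNorm f0 p volume ^ p.toReal = ENNReal.ofReal h * ‖x‖ₑ ^ p.toReal := by
    rw [sm_Lp_enorm p hp, sm_cell h hh _ (hf0m.enorm.pow_const _), sm_lp_enorm p hp]
    congr 2
    ext j
    have : ∀ θ ∈ Set.Ico (0:ℝ) 1, ‖f0 (((j:ℝ) + θ) * h)‖ₑ ^ p.toReal
        = ‖(x : ∀ _ : ℤ, Y) j‖ₑ ^ p.toReal := by
      intro θ hθ
      have : ⌊(((j:ℝ) + θ) * h) / h⌋ = j := by
        rw [mul_div_cancel_right₀ _ hh.ne', Int.floor_eq_iff]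
        constructor <;> linarith [hθ.1, hθ.2]
      rw [hf0]
      simp only [this]
    rw [setLIntegral_congr_fun measurableSet_Ico this]
    simp
  have hmem : MemLp f0 p volume := by
    refine ⟨hf0m.aestronglyMeasurable, ?_⟩
    have : eLpNorm f0 p volume ^ p.toReal < ∞ := by
      rw [hf0n]
      exact ENNReal.mul_lt_top ENNReal.ofReal_lt_top (ENNReal.rpow_lt_top_of_nonneg hp.le enorm_ne_top)
    by_contra hcon
    rw [not_lt, top_le_iff] at hcon
    rw [hcon, ENNReal.top_rpow_of_pos hp] at this
    exact lt_irrefl _ this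
  set f : Lp Y p (volume : Measure ℝ) := hmem.toLp f0 with hf
  have hff0 : (f : ℝ → Y) =ᵐ[volume] f0 := hmem.coeFn_toLp
  have key : ∀ j : ℤ, (z : ∀ _ : ℤ, Y) j =
      ∫ θ in Set.Ico (0:ℝ) 1, (Cb f : ℝ → Y) (((j:ℝ) + θ) * h) := by
    intro j
    have hint := (sm_lemma_sum ((volume.restrict (Set.Ico (0:ℝ) 1)).prod volume)
      (fun ω : ℝ × ℝ => b ω.2) (hb.comp_snd _) (fun ω => ⌈ω.2 / h - ω.1⌉₊)
      (Nat.measurable_ceil.comp (by fun_prop)) (fun k => (x : ∀ _ : ℤ, Y) (j - (k : ℤ))) ‖x‖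
      (fun k => lp.norm_apply_le_norm hp0.ne' x _)).1
    rw [hz j, integral_prod _ hint]
    refine integral_congr_ae ?_
    have h1 := (sm_qmp h hh (j:ℝ)).ae (hCb f)
    filter_upwards [h1, ae_restrict_mem measurableSet_Ico] with θ hθ hθI
    rw [hθ]
    refine integral_congr_ae ?_
    have h2 := (quasiMeasurePreserving_sub_left volume (((j:ℝ) + θ) * h)).ae hff0
    filter_upwards [h2] with t ht
    rw [ht]
    by_cases ht0 : 0 ≤ t
    · simp only [hf0]
      rw [sm_floor h θ t hh ht0 hθI.2 j]
    · have : b t = 0 := by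
        by_contra hne
        exact ht0 (hbsupp hne)
      simp [this]
  have hCm : StronglyMeasurable (Cb f : ℝ → Y) := Lp.stronglyMeasurable _
  have hj : ∀ j : ℤ, ‖(z : ∀ _ : ℤ, Y) j‖ₑ ^ p.toReal ≤
      ∫⁻ θ in Set.Ico (0:ℝ) 1, ‖(Cb f : ℝ → Y) (((j:ℝ) + θ) * h)‖ₑ ^ p.toReal := by
    intro j
    rw [← sm_Lp_enorm p hp]
    refine ENNReal.rpow_le_rpow ?_ hp.le
    rw [key j]
    refine (enorm_integral_le_lintegral_enorm _).trans ?_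
    rw [← eLpNorm_one_eq_lintegral_enorm]
    refine eLpNorm_le_eLpNorm_of_exponent_le Fact.out ?_
    exact (hCm.comp_measurable (by fun_prop)).aestronglyMeasurable
  have hfin : ENNReal.ofReal h * ‖z‖ₑ ^ p.toReal ≤
      ENNReal.ofReal h * (‖Cb‖ₑ * ‖x‖ₑ) ^ p.toReal := by
    calc ENNReal.ofReal h * ‖z‖ₑ ^ p.toReal
        ≤ ‖Cb f‖ₑ ^ p.toReal := by
          rw [Lp.enorm_def, sm_Lp_enorm p hp, sm_cell h hh _ (hCm.enorm.pow_const _),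
            sm_lp_enorm p hp]
          gcongr
          exact hj _
      _ ≤ (‖Cb‖ₑ * ‖f‖ₑ) ^ p.toReal := by
          gcongr
          exact Cb.le_opENorm f
      _ = ENNReal.ofReal h * (‖Cb‖ₑ * ‖x‖ₑ) ^ p.toReal := by
          rw [ENNReal.mul_rpow_of_nonneg _ _ hp.le, ENNReal.mul_rpow_of_nonneg _ _ hp.le,
            Lp.enorm_def, eLpNorm_congr_ae hff0, hf0n]
          ring
  rw [ENNReal.mul_le_mul_iff_right (by simpa using hh) ENNReal.ofReal_ne_top,
    ENNReal.rpow_le_rpow_iff hp] at hfin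
  have := ENNReal.toReal_mono (by finiteness) hfin
  simpa using this

theorem sm_S (p : ℝ≥0∞) [Fact (1 ≤ p)] (hp : 0 < p.toReal)
    {Y : Type*} [NormedAddCommGroup Y] [NormedSpace ℂ Y]
    (S : lp (fun _ : ℤ => Y) p →L[ℂ] lp (fun _ : ℤ => Y) p)
    (hS : ∀ (x : lp (fun _ : ℤ => Y) p) (j : ℤ),
      (S x : ∀ _ : ℤ, Y) j = (x : ∀ _ : ℤ, Y) (j - 1)) (k : ℕ) :
    (∀ (x : lp (fun _ : ℤ => Y) p) (j : ℤ),
      ((S ^ k) x : ∀ _ : ℤ, Y) j = (x : ∀ _ : ℤ, Y) (j - k)) ∧ ‖S ^ k‖ ≤ 1 := by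
  have h1 : ∀ (x : lp (fun _ : ℤ => Y) p) (j : ℤ),
      ((S ^ k) x : ∀ _ : ℤ, Y) j = (x : ∀ _ : ℤ, Y) (j - k) := by
    induction k with
    | zero => simp
    | succ k ih =>
      intro x j
      rw [pow_succ', mul_apply_eq_comp, hS, ih]
      push_cast
      ring_nf
  refine ⟨h1, ContinuousLinearMap.opNorm_le_bound _ zero_le_one fun x => ?_⟩
  rw [one_mul]
  have : ‖(S ^ k) x‖ ^ p.toReal = ‖x‖ ^ p.toReal := by
    rw [lp.norm_rpow_eq_tsum hp, lp.norm_rpow_eq_tsum hp]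
    simp_rw [h1]
    exact (Equiv.subRight (k : ℤ)).tsum_eq (fun i => ‖(x : ∀ _ : ℤ, Y) i‖ ^ p.toReal)
  exact ((Real.rpow_left_inj (norm_nonneg _) (norm_nonneg _) hp.ne').1 this).le

theorem sm_step (p : ℝ≥0∞) [Fact (1 ≤ p)] (hp : 0 < p.toReal)
    {X : Type*} [NormedAddCommGroup X] [NormedSpace ℂ X] [CompleteSpace X]
    {Y : Type*} [NormedAddCommGroup Y] [NormedSpace ℂ Y] [CompleteSpace Y]
    (S : lp (fun _ : ℤ => Y) p →L[ℂ] lp (fun _ : ℤ => Y) p)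
    (hS : ∀ (x : lp (fun _ : ℤ => Y) p) (j : ℤ),
      (S x : ∀ _ : ℤ, Y) j = (x : ∀ _ : ℤ, Y) (j - 1))
    (R : X →L[ℂ] X) (hR : ∀ k : ℕ, ‖R ^ k‖ ≤ 1)
    (hM : ∀ P : Polynomial ℂ, ‖Polynomial.aeval R P‖ ≤ ‖Polynomial.aeval S P‖)
    (b : ℝ → ℂ) (hb : Integrable b (volume : Measure ℝ))
    (hbsupp : Function.support b ⊆ Set.Ici 0)
    (Cb : Lp Y p (volume : Measure ℝ) →L[ℂ] Lp Y p (volume : Measure ℝ))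
    (hCb : ∀ f : Lp Y p (volume : Measure ℝ),
      ∀ᵐ s : ℝ, (Cb f : ℝ → Y) s = ∫ t : ℝ, b t • (f : ℝ → Y) (s - t))
    (h : ℝ) (hh : 0 < h) (v : X) :
    ‖∫ ω : ℝ × ℝ, b ω.2 • (R ^ ⌈ω.2 / h - ω.1⌉₊) v
        ∂((volume.restrict (Set.Ico (0:ℝ) 1)).prod volume)‖ ≤ ‖Cb‖ * ‖v‖ := by
  obtain ⟨hp0, hp1⟩ := ENNReal.toReal_pos_iff.1 hp
  set M := (volume.restrict (Set.Ico (0:ℝ) 1)).prod (volume : Measure ℝ) with hMdef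
  set N : ℝ × ℝ → ℕ := fun ω => ⌈ω.2 / h - ω.1⌉₊ with hN
  have hNm : Measurable N := Nat.measurable_ceil.comp (by fun_prop)
  have hg : Integrable (fun ω : ℝ × ℝ => b ω.2) M := hb.comp_snd _
  set a : ℕ → ℂ := fun k => ∫ ω in N ⁻¹' {k}, b ω.2 ∂M with ha
  have hasum : Summable (fun k => ‖a k‖) := sm_summable M _ hg N hNm
  have hSs : Summable (fun k => a k • S ^ k) := by
    refine Summable.of_norm_bounded hasum fun k => ?_
    rw [norm_smul]
    exact mul_le_of_le_one_right (norm_nonneg _) (sm_S p hp S hS k).2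
  have hRs : Summable (fun k => a k • R ^ k) := by
    refine Summable.of_norm_bounded hasum fun k => ?_
    rw [norm_smul]
    exact mul_le_of_le_one_right (norm_nonneg _) (hR k)
  have hle : ‖∑' k, a k • R ^ k‖ ≤ ‖∑' k, a k • S ^ k‖ := by
    refine le_of_tendsto_of_tendsto' hRs.hasSum.tendsto_sum_nat.norm
      hSs.hasSum.tendsto_sum_nat.norm fun n => ?_
    have := hM (∑ k ∈ Finset.range n, Polynomial.C (a k) * Polynomial.X ^ k)
    simpa [map_sum, Algebra.smul_def] using this
  have hB : ‖∑' k, a k • S ^ k‖ ≤ ‖Cb‖ := by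
    refine ContinuousLinearMap.opNorm_le_bound _ (norm_nonneg _) fun x => ?_
    refine sm_Y p hp b hb hbsupp Cb hCb h hh x _ fun j => ?_
    have h1 := (sm_lemma_sum M _ hg N hNm (fun k => (x : ∀ _ : ℤ, Y) (j - (k : ℤ))) ‖x‖
      (fun k => lp.norm_apply_le_norm hp0.ne' x _)).2
    have h2 := hSs.hasSum.mapL
      ((lp.evalCLM ℂ (fun _ : ℤ => Y) p j).comp (ContinuousLinearMap.apply ℂ _ x))
    refine HasSum.unique ?_ h1
    convert h2 using 2 with k
    · simp only [ContinuousLinearMap.comp_apply, ContinuousLinearMap.apply_apply]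
      rw [smul_apply, map_smul]
      congr 1
      exact ((sm_S p hp S hS k).1 x j).symm
    · rfl
  have h1 := (sm_lemma_sum M _ hg N hNm (fun k => (R ^ k) v) ‖v‖
      (fun k => ((R ^ k).le_opNorm v).trans (mul_le_of_le_one_left (norm_nonneg _) (hR k)))).2
  have h2 := hRs.hasSum.mapL (ContinuousLinearMap.apply ℂ _ v)
  have h3 := HasSum.unique h1 h2
  rw [h3]
  exact ((∑' k, a k • R ^ k).le_opNorm v).trans
    (mul_le_mul_of_nonneg_right (hle.trans hB) (norm_nonneg _))

/-- Let `1 < p < ∞`, let `X, Y` be complex Banach spaces and let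
`(T_t)_{t≥0}` be a `C₀`-semigroup of contractions on `X` such that for every `t ≥ 0` and
every complex polynomial `P` one has `‖P(T_t)‖ ≤ ‖P(S) ⊗ Id_Y‖_{ℓ^p(ℤ;Y)→ℓ^p(ℤ;Y)}`.
Then for every `b ∈ L¹(ℝ)` with support contained in `[0,∞)`,
`‖∫_0^∞ b(t) T_t dt‖ ≤ ‖C_b ⊗ Id_Y‖_{L^p(ℝ;Y)→L^p(ℝ;Y)}`. -/
theorem semigroup_matsaev_convolution (p : ℝ≥0∞) [Fact (1 ≤ p)] (hp : 1 < p) (hp' : p ≠ ∞)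
    (X : Type*) [NormedAddCommGroup X] [NormedSpace ℂ X] [CompleteSpace X]
    (Y : Type*) [NormedAddCommGroup Y] [NormedSpace ℂ Y] [CompleteSpace Y]
    (T : ℝ → (X →L[ℂ] X))
    (hT0 : T 0 = 1)
    (hTadd : ∀ s t : ℝ, 0 ≤ s → 0 ≤ t → T (s + t) = (T s).comp (T t))
    (hTcontr : ∀ t : ℝ, 0 ≤ t → ‖T t‖ ≤ 1)
    (hTcont : ∀ x : X, ContinuousOn (fun t : ℝ => T t x) (Set.Ici 0))
    (S : lp (fun _ : ℤ => Y) p →L[ℂ] lp (fun _ : ℤ => Y) p)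
    (hS : ∀ (x : lp (fun _ : ℤ => Y) p) (j : ℤ),
      (S x : ∀ _ : ℤ, Y) j = (x : ∀ _ : ℤ, Y) (j - 1))
    (hMatsaev : ∀ t : ℝ, 0 ≤ t → ∀ P : Polynomial ℂ,
      ‖Polynomial.aeval (T t) P‖ ≤ ‖Polynomial.aeval S P‖)
    (b : ℝ → ℂ) (hb : Integrable b (volume : Measure ℝ))
    (hbsupp : Function.support b ⊆ Set.Ici 0)
    (Cb : Lp Y p (volume : Measure ℝ) →L[ℂ] Lp Y p (volume : Measure ℝ))
    (hCb : ∀ f : Lp Y p (volume : Measure ℝ),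
      ∀ᵐ s : ℝ, (Cb f : ℝ → Y) s = ∫ t : ℝ, b t • (f : ℝ → Y) (s - t))
    (A : X →L[ℂ] X)
    (hA : ∀ x : X, A x = ∫ t in Set.Ici (0:ℝ), b t • T t x) :
    ‖A‖ ≤ ‖Cb‖ := by
  have hpr : 0 < p.toReal := ENNReal.toReal_pos (zero_lt_one.trans hp).ne' hp'
  refine ContinuousLinearMap.opNorm_le_bound _ (norm_nonneg _) fun v => ?_
  have hpow : ∀ t : ℝ, 0 ≤ t → ∀ k : ℕ, T t ^ k = T (k * t) := by
    intro t ht k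
    induction k with
    | zero => simp [hT0]
    | succ k ih =>
      rw [pow_succ, ih, Nat.cast_succ, add_mul, one_mul, hTadd _ _ (by positivity) ht]
      rfl
  set M := (volume.restrict (Set.Ico (0:ℝ) 1)).prod (volume : Measure ℝ) with hMdef
  have : IsProbabilityMeasure (volume.restrict (Set.Ico (0:ℝ) 1)) := ⟨by simp⟩
  have hAv : A v = ∫ ω : ℝ × ℝ, b ω.2 • T ω.2 v ∂M := by
    rw [hA, integral_fun_snd (fun t => b t • T t v), probReal_univ, one_smul]
    refine setIntegral_eq_integral_of_forall_compl_eq_zero fun t ht => ?_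
    have : b t = 0 := by
      by_contra hne
      exact ht (hbsupp hne)
    simp [this]
  set h : ℕ → ℝ := fun n => 1 / ((n:ℝ) + 1) with hh
  have hpos : ∀ n, 0 < h n := fun n => by positivity
  have hlim0 : Filter.Tendsto h Filter.atTop (nhds 0) := tendsto_one_div_add_atTop_nhds_zero_nat
  have hbound : ∀ t : ℝ, 0 ≤ t → ‖T t v‖ ≤ ‖v‖ := fun t ht =>
    ((T t).le_opNorm v).trans (mul_le_of_le_one_left (norm_nonneg _) (hTcontr t ht))
  have hg : Integrable (fun ω : ℝ × ℝ => b ω.2) M := hb.comp_snd _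
  have hlim : Filter.Tendsto
      (fun n => ∫ ω : ℝ × ℝ, b ω.2 • (T (h n) ^ ⌈ω.2 / h n - ω.1⌉₊) v ∂M) Filter.atTop
      (nhds (∫ ω : ℝ × ℝ, b ω.2 • T ω.2 v ∂M)) := by
    refine tendsto_integral_of_dominated_convergence (fun ω => ‖b ω.2‖ * ‖v‖) ?_
      (hg.norm.mul_const _) ?_ ?_
    · intro n
      refine (sm_lemma_sum M _ hg (fun ω => ⌈ω.2 / h n - ω.1⌉₊)
        (Nat.measurable_ceil.comp (by fun_prop)) (fun k => (T (h n) ^ k) v) ‖v‖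
        fun k => ?_).1.aestronglyMeasurable
      rw [hpow _ (hpos n).le]
      exact hbound _ (mul_nonneg (Nat.cast_nonneg _) (hpos n).le)
    · intro n
      refine Filter.Eventually.of_forall fun ω => ?_
      rw [norm_smul, hpow _ (hpos n).le]
      exact mul_le_mul_of_nonneg_left (hbound _ (mul_nonneg (Nat.cast_nonneg _) (hpos n).le))
        (norm_nonneg _)
    · have hae : ∀ᵐ ω : ℝ × ℝ ∂M, ω.1 ∈ Set.Ico (0:ℝ) 1 :=
        Measure.quasiMeasurePreserving_fst.ae (ae_restrict_mem measurableSet_Ico)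
      filter_upwards [hae] with ω hω
      by_cases ht : 0 ≤ ω.2
      · refine Filter.Tendsto.const_smul ?_ _
        have hc := hTcont v ω.2 ht
        have hu : Filter.Tendsto (fun n => (⌈ω.2 / h n - ω.1⌉₊ : ℝ) * h n) Filter.atTop
            (nhds ω.2) := by
          rw [tendsto_iff_dist_tendsto_zero]
          refine squeeze_zero (fun _ => dist_nonneg) (fun n => ?_) hlim0
          have hn := hpos n
          have hq : 0 ≤ ω.2 / h n := by positivity
          have e : (⌈ω.2 / h n - ω.1⌉₊ : ℝ) * h n - ω.2
              = ((⌈ω.2 / h n - ω.1⌉₊ : ℝ) - ω.2 / h n) * h n := by field_simp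
          rw [Real.dist_eq, e, abs_mul, abs_of_pos hn]
          refine mul_le_of_le_one_left hn.le ?_
          rw [abs_le]
          have l1 := Nat.le_ceil (ω.2 / h n - ω.1)
          have l2 : (⌈ω.2 / h n - ω.1⌉₊ : ℝ) ≤ ω.2 / h n + 1 := by
            refine le_trans (Nat.cast_le.2 (Nat.ceil_mono ?_)) (Nat.ceil_lt_add_one hq).le
            linarith [hω.1]
          constructor <;> linarith [hω.1, hω.2]
        have hu' : Filter.Tendsto (fun n => (⌈ω.2 / h n - ω.1⌉₊ : ℝ) * h n) Filter.atTop
            (nhdsWithin ω.2 (Set.Ici 0)) :=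
          tendsto_nhdsWithin_iff.2 ⟨hu, Filter.Eventually.of_forall fun n =>
            mul_nonneg (Nat.cast_nonneg _) (hpos n).le⟩
        have hcomp := hc.tendsto.comp hu'
        refine hcomp.congr fun n => ?_
        simp only [Function.comp_apply]
        rw [hpow _ (hpos n).le]
      · have : b ω.2 = 0 := by
          by_contra hne
          exact ht (hbsupp hne)
        simp [this]
  rw [hAv]
  refine le_of_tendsto' hlim.norm fun n => ?_
  refine sm_step p hpr S hS (T (h n)) (fun k => ?_) (hMatsaev _ (hpos n).le) b hb hbsupp Cb hCb
    (h n) (hpos n) v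
  rw [hpow _ (hpos n).le]
  exact hTcontr _ (mul_nonneg (Nat.cast_nonneg _) (hpos n).le)
end
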